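/- Let G be a group and let X and Y be cocompact G-trees. The following conditions are equivalent: (1) X and Y have the same elliptic subgroups; (2) there exists an elementary deformation from X to Y; (3) there exists a coarsely equivariant quasi-isometry φ : X → Y. -/

import Mathlib

universe u

/-- A `G`-tree: a simplicial tree together with an action of `G` by graph
automorphisms without inversions. -/
structure GTree (G : Type u) [Group G] : Type (u + 1) where
  V : Type u
  graph : SimpleGraph V
  isTree : graph.IsTree
  smul : G → V → V
  smul_one : ∀ x, smul 1 x = x
  smul_mul : ∀ γ δ x, smul (γ * δ) x = smul γ (smul δ x)
  smul_adj : ∀ (γ : G) ⦃x y : V⦄, graph.Adj x y → graph.Adj (smul γ x) (smul γ y)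
  no_inversions : ∀ (γ : G) (x y : V), graph.Adj x y → ¬(smul γ x = y ∧ smul γ y = x)

namespace GTree

variable {G : Type u} [Group G]

/-- Oriented edges of a `G`-tree. -/
def Edge (X : GTree G) : Type u := { p : X.V × X.V // X.graph.Adj p.1 p.2 }

/-- Initial vertex `∂₀ e` of an oriented edge. -/
def d0 {X : GTree G} (e : X.Edge) : X.V := e.1.1

/-- Terminal vertex `∂₁ e` of an oriented edge. -/
def d1 {X : GTree G} (e : X.Edge) : X.V := e.1.2

/-- The underlying geometric (unoriented) edge. -/
def esym {X : GTree G} (e : X.Edge) : Sym2 X.V := s(e.1.1, e.1.2)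

/-- Action of `G` on oriented edges. -/
def edgeSmul {X : GTree G} (γ : G) (e : X.Edge) : X.Edge :=
  ⟨(X.smul γ e.1.1, X.smul γ e.1.2), X.smul_adj γ e.2⟩

/-- Vertex stabilizer `G_x`. -/
def stab (X : GTree G) (x : X.V) : Subgroup G where
  carrier := { γ | X.smul γ x = x }
  one_mem' := X.smul_one x
  mul_mem' := by
    intro a b ha hb
    simp only [Set.mem_setOf_eq] at *
    rw [X.smul_mul, hb, ha]
  inv_mem' := by
    intro a ha
    simp only [Set.mem_setOf_eq] at *
    conv_lhs => rw [← ha]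
    rw [← X.smul_mul, inv_mul_cancel, X.smul_one]

/-- Edge stabilizer `G_e`: the elements fixing both endpoints (since the action
is without inversions, these are exactly the elements fixing the edge). -/
def edgeStab (X : GTree G) (e : X.Edge) : Subgroup G :=
  X.stab (d0 e) ⊓ X.stab (d1 e)

/-- An element of `G` is elliptic if it fixes a vertex. -/
def Elliptic (X : GTree G) (γ : G) : Prop := ∃ x, X.smul γ x = x

/-- A subgroup of `G` is elliptic if it fixes a vertex. -/
def FixesVertex (X : GTree G) (H : Subgroup G) : Prop := ∃ x, ∀ γ ∈ H, X.smul γ x = x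

/-- Two `G`-trees have the same elliptic subgroups. -/
def SameEllipticSubgroups (X Y : GTree G) : Prop :=
  ∀ H : Subgroup G, X.FixesVertex H ↔ Y.FixesVertex H

/-- The length function `ℓ_X(γ)`: the minimal vertex displacement. -/
noncomputable def transLen (X : GTree G) (γ : G) : ℕ :=
  sInf (Set.range fun x => X.graph.dist x (X.smul γ x))

/-- Cocompact: the quotient graph `G\X` is finite, i.e. there are finitely
many orbits of vertices and of edges. -/
def Cocompact (X : GTree G) : Prop :=
  Finite (Quot fun x y : X.V => ∃ γ, X.smul γ x = y) ∧
    Finite (Quot fun e f : X.Edge => ∃ γ, edgeSmul γ e = f)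

/-- Reduced: whenever `G_e = G_{∂₀ e}`, the endpoints of `e` are in the same
`G`-orbit. -/
def Reduced (X : GTree G) : Prop :=
  ∀ e : X.Edge, X.edgeStab e = X.stab (d0 e) → ∃ γ, X.smul γ (d0 e) = d1 e

/-- A nonempty `G`-invariant subtree (a nonempty invariant set of vertices that
is connected in the induced graph). -/
def IsInvariantSubtree (X : GTree G) (S : Set X.V) : Prop :=
  S.Nonempty ∧ (∀ γ, ∀ x ∈ S, X.smul γ x ∈ S) ∧
    ∀ x ∈ S, ∀ y ∈ S, ∃ p : X.graph.Walk x y, ∀ v ∈ p.support, v ∈ S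

/-- Minimal: there is no proper nonempty invariant subtree. -/
def Minimal (X : GTree G) : Prop :=
  ∀ S : Set X.V, X.IsInvariantSubtree S → S = Set.univ

/-- Strongly slide-free: minimal, and for all edges `e`, `f` with
`∂₀ e = ∂₀ f`, the inclusion `G_e ⊆ G_f` implies `f ∈ G e`. -/
def StronglySlideFree (X : GTree G) : Prop :=
  X.Minimal ∧ ∀ e f : X.Edge, d0 e = d0 f → X.edgeStab e ≤ X.edgeStab f →
    ∃ γ, edgeSmul γ e = f

/-- Proper: `G_e ⊊ G_{∂₀ e}` for every edge `e`. -/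
def Proper (X : GTree G) : Prop := ∀ e : X.Edge, X.edgeStab e < X.stab (d0 e)

/-- Locally finite: every vertex has finite valence. -/
def LocallyFinite (X : GTree G) : Prop := ∀ x : X.V, (X.graph.neighborSet x).Finite

/-- `φ` is an isomorphism of `G`-trees: an equivariant graph isomorphism. -/
def IsGIso (X Y : GTree G) (φ : X.V → Y.V) : Prop :=
  Function.Bijective φ ∧ (∀ x y, X.graph.Adj x y ↔ Y.graph.Adj (φ x) (φ y)) ∧
    ∀ γ x, φ (X.smul γ x) = Y.smul γ (φ x)

/-- `φ : X → Y` is the collapse move performed at (the orbit of) the edge `e`: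
`G_e = G_{∂₀ e}`, the endpoints of `e` lie in different `G`-orbits, and `Y` is
the equivariant quotient of `X` identifying `∂₀(γ e)` with `∂₁(γ e)` for all
`γ ∈ G`. -/
def IsCollapse (X Y : GTree G) (φ : X.V → Y.V) (e : X.Edge) : Prop :=
  X.edgeStab e = X.stab (d0 e) ∧
  (∀ γ : G, X.smul γ (d0 e) ≠ d1 e) ∧
  Function.Surjective φ ∧
  (∀ γ x, φ (X.smul γ x) = Y.smul γ (φ x)) ∧
  (∀ u v : X.V, φ u = φ v ↔
    Relation.EqvGen (fun a b => ∃ γ : G, a = X.smul γ (d0 e) ∧ b = X.smul γ (d1 e)) u v) ∧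
  (∀ a b : Y.V, a ≠ b → (Y.graph.Adj a b ↔ ∃ u v, X.graph.Adj u v ∧ φ u = a ∧ φ v = b))

/-- `Y` is obtained from `X` by a collapse move. -/
def Collapse (X Y : GTree G) : Prop := ∃ (φ : X.V → Y.V) (e : X.Edge), IsCollapse X Y φ e

/-- Elementary deformation: a finite composition of collapse moves and their
inverses (expansion moves). -/
def ElemDeformation : GTree G → GTree G → Prop := Relation.EqvGen Collapse

end GTree

namespace GTree

variable {G : Type u} [Group G]

/-- `f : X → Y` is a quasi-isometry of the vertex sets (with the path
metrics): there are `K ≥ 1`, `C ≥ 0` with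
`K⁻¹ d(x,x') − C ≤ d(f x, f x') ≤ K d(x,x') + C` for all `x, x'`, and every
vertex of `Y` lies within distance `C` of the image of `f`. -/
def IsQuasiIsometry (X Y : GTree G) (f : X.V → Y.V) : Prop :=
  ∃ K C : ℝ, 1 ≤ K ∧ 0 ≤ C ∧
    (∀ x x' : X.V,
      K⁻¹ * (X.graph.dist x x' : ℝ) - C ≤ (Y.graph.dist (f x) (f x') : ℝ) ∧
      (Y.graph.dist (f x) (f x') : ℝ) ≤ K * (X.graph.dist x x' : ℝ) + C) ∧
    ∀ y : Y.V, ∃ x : X.V, (Y.graph.dist (f x) y : ℝ) < C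

/-- `f : X → Y` is coarsely equivariant: `d(f (γ x), γ (f x)) < L` for some
constant `L` and all `γ`, `x`. -/
def CoarselyEquivariant (X Y : GTree G) (f : X.V → Y.V) : Prop :=
  ∃ L : ℝ, ∀ (γ : G) (x : X.V),
    (Y.graph.dist (f (X.smul γ x)) (Y.smul γ (f x)) : ℝ) < L

end GTree

namespace SimpleGraph

/-- A neighbour of `p` which is closer to `q`, or `p` itself if `p = q`. -/
noncomputable def toward {V : Type*} (T : SimpleGraph V) (p q : V) : V :=
  open Classical in
  if h : ∃ c, T.Adj p c ∧ T.dist c q + 1 = T.dist p q then h.choose else p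

/-- A connected graph in which every edge is the only edge leaving some set is a tree. -/
lemma isTree_of_cuts {V : Type*} {T : SimpleGraph V} (hc : T.Connected)
    (hD : ∀ a b, T.Adj a b → ∃ D : Set V, a ∈ D ∧ b ∉ D ∧
      ∀ x y, T.Adj x y → x ∈ D → y ∉ D → x = a ∧ y = b) : T.IsTree := by
  refine ⟨hc, isAcyclic_iff_forall_adj_isBridge.2 fun a b hab => ?_⟩
  rw [isBridge_iff]
  rintro ⟨w⟩
  obtain ⟨D, ha, hb, hcut⟩ := hD a b hab
  obtain ⟨d, hd, h1, h2⟩ := w.exists_boundary_dart D ha hb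
  have hadj := d.adj
  rw [deleteEdges_adj] at hadj
  obtain ⟨h3, h4⟩ := hcut _ _ hadj.1 h1 h2
  exact hadj.2 (by rw [h3, h4]; rfl)

namespace IsTree

variable {V : Type*} {T : SimpleGraph V} (hT : T.IsTree)
include hT

lemma exists_closer_neighbor {p q : V} (h : p ≠ q) :
    ∃ c, T.Adj p c ∧ T.dist c q + 1 = T.dist p q := by
  obtain ⟨w, hw⟩ := hT.1.exists_walk_length_eq_dist p q
  cases w with
  | nil => exact absurd rfl h
  | @cons _ c _ hadj w' =>
    refine ⟨c, hadj, ?_⟩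
    have h1 := dist_le w'
    have h2 : T.dist p q ≤ T.dist p c + T.dist c q := hT.1.dist_triangle
    rw [dist_eq_one_iff_adj.2 hadj] at h2
    rw [Walk.length_cons] at hw
    lia

lemma closer_neighbor_unique {p q c c' : V} (h : T.Adj p c) (hd : T.dist c q + 1 = T.dist p q)
    (h' : T.Adj p c') (hd' : T.dist c' q + 1 = T.dist p q) : c = c' := by
  have key : ∀ c, T.Adj p c → T.dist c q + 1 = T.dist p q →
      ∃ w : T.Walk p q, w.IsPath ∧ w.snd = c := by
    intro c h hd
    obtain ⟨w, hw⟩ := hT.1.exists_walk_length_eq_dist c q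
    refine ⟨.cons h w, Walk.isPath_of_length_eq_dist _ ?_, by simp⟩
    rw [Walk.length_cons, hw, hd]
  obtain ⟨w, hw, rfl⟩ := key c h hd
  obtain ⟨w', hw', rfl⟩ := key c' h' hd'
  rw [(hT.existsUnique_path p q).unique hw hw']

lemma toward_spec {p q : V} (h : p ≠ q) :
    T.Adj p (T.toward p q) ∧ T.dist (T.toward p q) q + 1 = T.dist p q := by
  have := hT.exists_closer_neighbor h
  rw [toward, dif_pos this]
  exact this.choose_spec

lemma adj_toward {p q : V} (h : p ≠ q) : T.Adj p (T.toward p q) := (hT.toward_spec h).1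

lemma dist_toward {p q : V} (h : p ≠ q) : T.dist (T.toward p q) q + 1 = T.dist p q :=
  (hT.toward_spec h).2

lemma eq_toward {p q c : V} (h : T.Adj p c) (hd : T.dist c q + 1 = T.dist p q) :
    c = T.toward p q := by
  have hne : p ≠ q := by
    rintro rfl
    simp at hd
  exact hT.closer_neighbor_unique h hd (hT.adj_toward hne) (hT.dist_toward hne)

omit hT in
lemma toward_self (p : V) : T.toward p p = p := by
  rw [toward, dif_neg]
  rintro ⟨c, _, h⟩
  simp at h

lemma dist_of_ne_toward {p q c : V} (h : T.Adj p c) (hne : c ≠ T.toward p q) :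
    T.dist c q = T.dist p q + 1 := by
  have h1 := hT.dist_eq_dist_add_one_of_adj q h
  rw [dist_comm (u := q), dist_comm (u := q)] at h1
  rcases h1 with h1 | h1
  · exact absurd (hT.eq_toward h h1.symm) hne
  · exact h1

lemma dist_eq_zero {p q : V} : T.dist p q = 0 ↔ p = q := hT.1.dist_eq_zero_iff

lemma toward_of_adj {p q : V} (h : T.Adj p q) : T.toward p q = q :=
  (hT.eq_toward h (by simp [dist_eq_one_iff_adj.2 h])).symm

/-- A point on a geodesic from `p` to `q` determines the first step. -/
lemma toward_eq_of_between {p q r : V} (h : p ≠ r) (hd : T.dist p r + T.dist r q = T.dist p q) :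
    T.toward p r = T.toward p q := by
  refine hT.eq_toward (hT.adj_toward h) ?_
  have h1 := hT.dist_toward h
  have h2 : T.dist (T.toward p r) q ≤ T.dist (T.toward p r) r + T.dist r q := hT.1.dist_triangle
  have h3 : T.dist p q ≤ T.dist p (T.toward p r) + T.dist (T.toward p r) q := hT.1.dist_triangle
  rw [dist_eq_one_iff_adj.2 (hT.adj_toward h)] at h3
  lia

lemma dist_add_of_toward_ne {p q r : V} (hr : r ≠ q)
    (h : T.toward q p ≠ T.toward q r) : T.dist p r = T.dist p q + T.dist q r := by
  induction hn : T.dist q r using Nat.strong_induction_on generalizing r with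
  | _ n ih =>
    by_cases hadj : T.Adj q r
    · rw [hT.toward_of_adj hadj] at h
      have := hT.dist_of_ne_toward hadj h.symm
      rw [dist_eq_one_iff_adj.2 hadj] at hn
      rw [dist_comm (u := p), dist_comm (u := p)]
      lia
    · set r' := T.toward r q with hr'
      have ha := hT.adj_toward hr
      have hd := hT.dist_toward hr
      rw [← hr'] at ha hd
      have hr'q : r' ≠ q := by
        rintro h'
        rw [h'] at ha
        exact hadj ha.symm
      have hd1 : T.dist q r' + T.dist r' r = T.dist q r := by
        rw [dist_comm (u := q), dist_comm (u := q), dist_eq_one_iff_adj.2 ha.symm, hd]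
      rw [dist_eq_one_iff_adj.2 ha.symm] at hd1
      have ht : T.toward q r' = T.toward q r :=
        hT.toward_eq_of_between hr'q.symm (by rw [dist_eq_one_iff_adj.2 ha.symm, hd1])
      have h1 := ih (T.dist q r') (by lia) hr'q (by rwa [ht]) rfl
      by_cases hrp : r = T.toward r' p
      · exfalso
        have h2 : T.toward r' q = T.toward r' p :=
          hT.toward_eq_of_between hr'q (by
            have e1 := T.dist_comm (u := r') (v := q)
            have e2 := T.dist_comm (u := q) (v := p)
            have e3 := T.dist_comm (u := r') (v := p)
            lia)
        have h3 := hT.dist_toward hr'q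
        rw [h2, ← hrp] at h3
        lia
      · have h2 := hT.dist_of_ne_toward ha.symm hrp
        rw [dist_comm (u := p), h2, dist_comm (u := r')]
        lia

/-- Interior points of a geodesic are strictly closer to any `z` than one of the endpoints. -/
lemma dist_toward_lt_max {p q : V} (h : 2 ≤ T.dist p q) (z : V) :
    T.dist (T.toward p q) z < max (T.dist p z) (T.dist q z) := by
  have hpq : p ≠ q := by
    rintro rfl
    simp at h
  have ha := hT.adj_toward hpq
  by_cases hz : z = p
  · subst hz
    rw [dist_comm, dist_eq_one_iff_adj.2 ha, dist_comm (u := q)]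
    exact lt_max_of_lt_right (by lia)
  by_cases hw : T.toward p q = T.toward p z
  · have := hT.dist_toward (Ne.symm hz)
    rw [hw]
    exact lt_max_of_lt_left (by lia)
  · have h1 := hT.dist_of_ne_toward ha hw
    have h2 := hT.dist_add_of_toward_ne hz hw
    rw [dist_comm (u := q) (v := p)] at h2
    exact lt_max_of_lt_right (by lia)

lemma toward_eq_toward_of_adj {u p q : V} (h : T.Adj p q) (hp : p ≠ u) (hq : q ≠ u) :
    T.toward u p = T.toward u q := by
  have h1 := dist_eq_one_iff_adj.2 h
  rcases hT.dist_eq_dist_add_one_of_adj u h with h2 | h2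
  · refine (hT.toward_eq_of_between hq.symm ?_).symm
    rw [dist_comm (u := q), h1, h2]
  · exact hT.toward_eq_of_between hp.symm (by rw [h1, h2])

/-- The only edge leaving the half-space of an edge is that edge. -/
lemma eq_of_adj_of_dist_lt {a b x y : V} (hab : T.Adj a b) (hxy : T.Adj x y)
    (hx : T.dist x a < T.dist x b) (hy : ¬ T.dist y a < T.dist y b) : x = a ∧ y = b := by
  have h1 := hT.dist_eq_dist_add_one_of_adj x hab
  have h2 := hT.dist_eq_dist_add_one_of_adj y hab
  have h3 := hT.dist_eq_dist_add_one_of_adj a hxy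
  have h4 := hT.dist_eq_dist_add_one_of_adj b hxy
  rw [dist_comm (u := a), dist_comm (u := a)] at h3
  rw [dist_comm (u := b), dist_comm (u := b)] at h4
  have hxa : x = a := by
    by_contra hxa
    have hxb : x ≠ b := by
      rintro rfl
      simp at hx
    have hyx : y = T.toward x b := hT.eq_toward hxy (by lia)
    have hax : T.toward x a = T.toward x b :=
      hT.toward_eq_of_between hxa (by rw [dist_eq_one_iff_adj.2 hab]; lia)
    have := hT.dist_toward hxa
    rw [hax, ← hyx] at this
    lia
  subst hxa
  refine ⟨rfl, hT.dist_eq_zero.1 ?_⟩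
  rw [dist_self] at *
  lia

end IsTree

/-- A map sending adjacent vertices to vertices at distance at most `K` is `K`-Lipschitz. -/
lemma Connected.dist_map_le {V W : Type*} {T : SimpleGraph V} {T' : SimpleGraph W}
    (hT : T.Connected) (hT' : T'.Connected) (φ : V → W) (K : ℕ)
    (h : ∀ x y, T.Adj x y → T'.dist (φ x) (φ y) ≤ K) (x y : V) :
    T'.dist (φ x) (φ y) ≤ K * T.dist x y := by
  obtain ⟨w, hw⟩ := hT.exists_walk_length_eq_dist x y
  rw [← hw]
  clear hw
  induction w with
  | nil => simp
  | @cons a b c hadj w ih =>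
    have h1 : T'.dist (φ a) (φ c) ≤ T'.dist (φ a) (φ b) + T'.dist (φ b) (φ c) := hT'.dist_triangle
    have h2 := h _ _ hadj
    rw [Walk.length_cons, mul_add, mul_one]
    lia

end SimpleGraph

namespace GTree

open SimpleGraph

variable {G : Type u} [Group G]

section Basic

variable (X : GTree G)

lemma smul_inv_smul (γ : G) (x : X.V) : X.smul γ (X.smul γ⁻¹ x) = x := by
  rw [← X.smul_mul, mul_inv_cancel, X.smul_one]

lemma inv_smul_smul (γ : G) (x : X.V) : X.smul γ⁻¹ (X.smul γ x) = x := by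
  rw [← X.smul_mul, inv_mul_cancel, X.smul_one]

lemma smul_injective (γ : G) : Function.Injective (X.smul γ) := fun x y h => by
  rw [← X.inv_smul_smul γ x, h, X.inv_smul_smul]

lemma dist_smul (γ : G) (x y : X.V) :
    X.graph.dist (X.smul γ x) (X.smul γ y) = X.graph.dist x y := by
  have key : ∀ (γ : G) x y, X.graph.dist (X.smul γ x) (X.smul γ y) ≤ X.graph.dist x y := by
    intro γ x y
    have := X.isTree.1.dist_map_le X.isTree.1 (X.smul γ) 1
      (fun x y h => (dist_eq_one_iff_adj.2 (X.smul_adj γ h)).le) x y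
    rwa [one_mul] at this
  refine (key γ x y).antisymm ?_
  simpa [X.inv_smul_smul] using key γ⁻¹ (X.smul γ x) (X.smul γ y)

lemma smul_toward (γ : G) (x y : X.V) :
    X.smul γ (X.graph.toward x y) = X.graph.toward (X.smul γ x) (X.smul γ y) := by
  by_cases h : x = y
  · rw [h, IsTree.toward_self, IsTree.toward_self]
  · exact X.isTree.eq_toward (X.smul_adj γ (X.isTree.adj_toward h))
      (by rw [X.dist_smul, X.dist_smul, X.isTree.dist_toward h])

/-- The orbits of vertices. -/
def VQuot : Type u := Quot fun x y : X.V => ∃ γ, X.smul γ x = y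

variable {X}

/-- The orbit of a vertex. -/
def VQuot.mk (x : X.V) : X.VQuot := Quot.mk _ x

lemma VQuot.mk_eq_iff {x y : X.V} : VQuot.mk x = VQuot.mk y ↔ ∃ γ, X.smul γ x = y := by
  refine ⟨fun h => ?_, fun h => Quot.sound h⟩
  refine (Equivalence.eqvGen_iff ⟨fun x => ⟨1, X.smul_one x⟩, ?_, ?_⟩).1 (Quot.eqvGen_exact h)
  · rintro x _ ⟨γ, rfl⟩
    exact ⟨γ⁻¹, X.inv_smul_smul γ x⟩
  · rintro x _ _ ⟨γ, rfl⟩ ⟨δ, rfl⟩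
    exact ⟨δ * γ, X.smul_mul δ γ x⟩

lemma VQuot.mk_smul (γ : G) (x : X.V) : VQuot.mk (X.smul γ x) = VQuot.mk x :=
  (VQuot.mk_eq_iff.2 ⟨γ, rfl⟩).symm

lemma VQuot.mk_surjective : Function.Surjective (VQuot.mk (X := X)) := Quot.mk_surjective

lemma mem_stab {γ : G} {x : X.V} : γ ∈ X.stab x ↔ X.smul γ x = x := Iff.rfl

end Basic

/-- Equivariant maps on vertices. -/
def Equivariant (X Y : GTree G) (f : X.V → Y.V) : Prop :=
  ∀ γ x, f (X.smul γ x) = Y.smul γ (f x)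

/-- If every vertex stabilizer of `X` fixes a vertex of `Y`, there is an equivariant map. -/
lemma exists_equivariant {X Y : GTree G} (h : ∀ x, ∃ y, X.stab x ≤ Y.stab y) :
    ∃ f : X.V → Y.V, Equivariant X Y f := by
  choose F hF using h
  choose r hr using VQuot.mk_surjective (X := X)
  have hr' : ∀ x : X.V, ∃ γ, X.smul γ (r (VQuot.mk x)) = x := fun x => VQuot.mk_eq_iff.1 (hr _)
  choose g hg using hr'
  refine ⟨fun x => Y.smul (g x) (F (r (VQuot.mk x))), fun γ x => ?_⟩
  have h1 := hg (X.smul γ x)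
  simp only [VQuot.mk_smul] at h1 ⊢
  have h2 : (γ * g x)⁻¹ * g (X.smul γ x) ∈ X.stab (r (VQuot.mk x)) := by
    have h3 : X.smul γ x = X.smul (γ * g x) (r (VQuot.mk x)) := by rw [X.smul_mul, hg]
    rw [mem_stab, X.smul_mul, h1, h3, X.inv_smul_smul]
  have h3 := mem_stab.1 (hF _ h2)
  rw [← Y.smul_mul]
  conv_rhs => rw [← h3]
  rw [← Y.smul_mul, mul_inv_cancel_left]

/-- Equivariant Lipschitz maps in both directions which are coarsely inverse to each other. -/
def EquivariantQI (X Y : GTree G) : Prop :=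
  ∃ (φ : X.V → Y.V) (σ : Y.V → X.V) (K C : ℕ), Equivariant X Y φ ∧ Equivariant Y X σ ∧
    (∀ x x', Y.graph.dist (φ x) (φ x') ≤ K * X.graph.dist x x') ∧
    (∀ y y', X.graph.dist (σ y) (σ y') ≤ K * Y.graph.dist y y') ∧
    (∀ x, X.graph.dist (σ (φ x)) x ≤ C) ∧ ∀ y, Y.graph.dist (φ (σ y)) y ≤ C

namespace EquivariantQI

variable {X Y Z : GTree G}

lemma refl (X : GTree G) : EquivariantQI X X :=
  ⟨id, id, 1, 0, fun _ _ => rfl, fun _ _ => rfl, by simp, by simp, by simp, by simp⟩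

lemma symm (h : EquivariantQI X Y) : EquivariantQI Y X := by
  obtain ⟨φ, σ, K, C, h1, h2, h3, h4, h5, h6⟩ := h
  exact ⟨σ, φ, K, C, h2, h1, h4, h3, h6, h5⟩

lemma trans (h : EquivariantQI X Y) (h' : EquivariantQI Y Z) : EquivariantQI X Z := by
  obtain ⟨φ, σ, K, C, h1, h2, h3, h4, h5, h6⟩ := h
  obtain ⟨φ', σ', K', C', h1', h2', h3', h4', h5', h6'⟩ := h'
  have e1 : K * C' ≤ K * C' + K' * C := by lia
  have e2 : K' * C ≤ K * C' + K' * C := by lia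
  refine ⟨φ' ∘ φ, σ ∘ σ', K * K', (K * C' + K' * C) + (C + C'), fun γ x => ?_, fun γ x => ?_,
    fun x x' => ?_, fun y y' => ?_, fun x => ?_, fun y => ?_⟩
  · simp only [Function.comp, h1 γ x, h1' γ]
  · simp only [Function.comp, h2' γ x, h2 γ]
  · exact (h3' _ _).trans (by
      rw [mul_comm K, mul_assoc]; exact Nat.mul_le_mul_left _ (h3 _ _))
  · exact (h4 _ _).trans (by
      rw [mul_assoc]; exact Nat.mul_le_mul_left _ (h4' _ _))
  · have t : X.graph.dist (σ (σ' (φ' (φ x)))) x ≤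
        X.graph.dist (σ (σ' (φ' (φ x)))) (σ (φ x)) + X.graph.dist (σ (φ x)) x :=
      X.isTree.1.dist_triangle
    have t1 := h4 (σ' (φ' (φ x))) (φ x)
    have t2 := Nat.mul_le_mul_left K (h5' (φ x))
    have t3 := h5 x
    simp only [Function.comp]
    lia
  · have t : Z.graph.dist (φ' (φ (σ (σ' y)))) y ≤
        Z.graph.dist (φ' (φ (σ (σ' y)))) (φ' (σ' y)) + Z.graph.dist (φ' (σ' y)) y :=
      Z.isTree.1.dist_triangle
    have t1 := h3' (φ (σ (σ' y))) (σ' y)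
    have t2 := Nat.mul_le_mul_left K' (h6 (σ' y))
    have t3 := h6' y
    simp only [Function.comp]
    lia

lemma sameElliptic (h : EquivariantQI X Y) : X.SameEllipticSubgroups Y := by
  obtain ⟨φ, σ, K, C, h1, h2, -⟩ := h
  refine fun H => ⟨?_, ?_⟩
  · rintro ⟨x, hx⟩
    exact ⟨φ x, fun γ hγ => by rw [← h1, hx γ hγ]⟩
  · rintro ⟨x, hx⟩
    exact ⟨σ x, fun γ hγ => by rw [← h2, hx γ hγ]⟩

lemma exists_quasiIsometry (h : EquivariantQI X Y) :
    ∃ φ : X.V → Y.V, IsQuasiIsometry X Y φ ∧ CoarselyEquivariant X Y φ := by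
  obtain ⟨φ, σ, K, C, h1, h2, h3, h4, h5, h6⟩ := h
  refine ⟨φ, ⟨K + 1, 2 * C + 1, by simp, by positivity, fun x x' => ⟨?_, ?_⟩, fun y => ⟨σ y, ?_⟩⟩,
    1, fun γ x => ?_⟩
  · have t : X.graph.dist x x' ≤ K * Y.graph.dist (φ x) (φ x') + 2 * C := by
      have t1 : X.graph.dist x x' ≤ X.graph.dist x (σ (φ x)) + X.graph.dist (σ (φ x)) x' :=
        X.isTree.1.dist_triangle
      have t2 : X.graph.dist (σ (φ x)) x' ≤
          X.graph.dist (σ (φ x)) (σ (φ x')) + X.graph.dist (σ (φ x')) x' :=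
        X.isTree.1.dist_triangle
      have t3 := h5 x
      rw [dist_comm] at t3
      have t4 := h5 x'
      have t5 := h4 (φ x) (φ x')
      lia
    have t' : (X.graph.dist x x' : ℝ) ≤ K * Y.graph.dist (φ x) (φ x') + 2 * C := by
      exact_mod_cast t
    have hK : (0 : ℝ) < K + 1 := by positivity
    rw [sub_le_iff_le_add, inv_mul_le_iff₀ hK]
    have p1 : (0 : ℝ) ≤ Y.graph.dist (φ x) (φ x') := by positivity
    have p2 : (0 : ℝ) ≤ C := by positivity
    have p3 : (0 : ℝ) ≤ K := by positivity
    nlinarith [mul_nonneg p3 p2]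
  · have t : (Y.graph.dist (φ x) (φ x') : ℝ) ≤ K * X.graph.dist x x' := by exact_mod_cast h3 x x'
    have p1 : (0 : ℝ) ≤ X.graph.dist x x' := by positivity
    have p2 : (0 : ℝ) ≤ C := by positivity
    linarith
  · have t : (Y.graph.dist (φ (σ y)) y : ℝ) ≤ C := by exact_mod_cast h6 y
    have p2 : (0 : ℝ) ≤ C := by positivity
    linarith
  · rw [h1]
    simp

end EquivariantQI

namespace IsCollapse

variable {X Y : GTree G} {φ : X.V → Y.V} {e : X.Edge}

/-- The vertices of the collapsed star at the end `∂₁ e` form an equivariant section. -/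
lemma exists_section (h : IsCollapse X Y φ e) : ∃ σ : Y.V → X.V, Equivariant Y X σ ∧
    (∀ y, φ (σ y) = y) ∧ ∀ x, X.graph.dist (σ (φ x)) x ≤ 1 := by
  classical
  obtain ⟨hst, hne, hsurj, heq, hrel, -⟩ := h
  have hst' : ∀ γ, X.smul γ (d0 e) = d0 e → X.smul γ (d1 e) = d1 e := fun γ hγ => by
    have : γ ∈ X.edgeStab e := by rw [hst]; exact hγ
    exact this.2
  have hex : ∀ x : X.V, ∃ x', (∀ γ, x = X.smul γ (d0 e) → x' = X.smul γ (d1 e)) ∧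
      ((∀ γ, x ≠ X.smul γ (d0 e)) → x' = x) := by
    intro x
    by_cases hx : ∃ γ, x = X.smul γ (d0 e)
    · obtain ⟨γ, rfl⟩ := hx
      refine ⟨X.smul γ (d1 e), fun δ hδ => ?_, fun h => absurd rfl (h γ)⟩
      have := hst' (δ⁻¹ * γ) (by rw [X.smul_mul, hδ, X.inv_smul_smul])
      rw [← X.smul_inv_smul δ (X.smul γ (d1 e)), ← X.smul_mul δ⁻¹, this]
    · push Not at hx
      exact ⟨x, fun γ h => absurd h (hx γ), fun _ => rfl⟩
  choose r hr0 hr1 using hex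
  have hrd1 : ∀ γ, r (X.smul γ (d1 e)) = X.smul γ (d1 e) := fun γ => hr1 _ fun δ h =>
    hne (γ⁻¹ * δ) (by rw [X.smul_mul, ← h, X.inv_smul_smul])
  have hφr : ∀ x, φ (r x) = φ x := by
    intro x
    by_cases hx : ∃ γ, x = X.smul γ (d0 e)
    · obtain ⟨γ, rfl⟩ := hx
      rw [hr0 _ γ rfl]
      exact (hrel _ _).2 (.symm _ _ (.rel _ _ ⟨γ, rfl, rfl⟩))
    · push Not at hx
      rw [hr1 x hx]
  have hrφ : ∀ x x', φ x = φ x' → r x = r x' := by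
    intro x x' hxx
    have := (hrel _ _).1 hxx
    clear hxx
    induction this with
    | rel a b hab =>
      obtain ⟨γ, rfl, rfl⟩ := hab
      rw [hr0 _ γ rfl, hrd1]
    | refl => rfl
    | symm _ _ _ ih => exact ih.symm
    | trans _ _ _ _ _ ih ih' => exact ih.trans ih'
  have hrsmul : ∀ γ x, r (X.smul γ x) = X.smul γ (r x) := by
    intro γ x
    by_cases hx : ∃ δ, x = X.smul δ (d0 e)
    · obtain ⟨δ, rfl⟩ := hx
      rw [hr0 _ δ rfl, hr0 _ (γ * δ) (X.smul_mul _ _ _).symm, X.smul_mul]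
    · push Not at hx
      rw [hr1 x hx, hr1]
      intro δ h
      exact hx (γ⁻¹ * δ) (by rw [X.smul_mul, ← h, X.inv_smul_smul])
  choose t ht using hsurj
  refine ⟨fun y => r (t y), fun γ y => ?_, fun y => ?_, fun x => ?_⟩
  · rw [← hrsmul]
    exact hrφ _ _ (by rw [ht, heq, ht])
  · rw [hφr, ht]
  · have : r (t (φ x)) = r x := hrφ _ _ (ht _)
    simp only [this]
    by_cases hx : ∃ γ, x = X.smul γ (d0 e)
    · obtain ⟨γ, rfl⟩ := hx
      rw [hr0 _ γ rfl, X.dist_smul, dist_comm]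
      exact (dist_eq_one_iff_adj.2 e.2).le
    · push Not at hx
      rw [hr1 x hx]
      simp

lemma equivariantQI (h : IsCollapse X Y φ e) : EquivariantQI X Y := by
  obtain ⟨σ, hσ, hφσ, hσφ⟩ := h.exists_section
  obtain ⟨hst, hne, hsurj, heq, hrel, hadj⟩ := h
  refine ⟨φ, σ, 3, 1, heq, hσ, fun x x' => ?_, ?_, hσφ, fun y => by simp [hφσ]⟩
  · refine X.isTree.1.dist_map_le Y.isTree.1 φ 3 (fun a b hab => ?_) x x'
    by_cases h : φ a = φ b
    · simp [h]
    · rw [dist_eq_one_iff_adj.2 ((hadj _ _ h).2 ⟨a, b, hab, rfl, rfl⟩)]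
      lia
  · refine Y.isTree.1.dist_map_le X.isTree.1 σ 3 fun a b hab => ?_
    obtain ⟨u, v, huv, rfl, rfl⟩ := (hadj _ _ hab.ne).1 hab
    have t1 : X.graph.dist (σ (φ u)) (σ (φ v)) ≤
      X.graph.dist (σ (φ u)) u + X.graph.dist u (σ (φ v)) := X.isTree.1.dist_triangle
    have t2 : X.graph.dist u (σ (φ v)) ≤ X.graph.dist u v + X.graph.dist v (σ (φ v)) :=
      X.isTree.1.dist_triangle
    rw [dist_eq_one_iff_adj.2 huv] at t2
    have t3 := hσφ v
    rw [dist_comm] at t3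
    have t4 := hσφ u
    lia

end IsCollapse

lemma ElemDeformation.equivariantQI {X Y : GTree G} (h : ElemDeformation X Y) :
    EquivariantQI X Y := by
  induction h with
  | rel _ _ h =>
    obtain ⟨φ, e, h⟩ := h
    exact h.equivariantQI
  | refl => exact .refl _
  | symm _ _ _ ih => exact ih.symm
  | trans _ _ _ _ _ ih₁ ih₂ => exact ih₁.trans ih₂

/-- A subgroup with a bounded orbit fixes a vertex. -/
lemma fixesVertex_of_bounded {X : GTree G} (H : Subgroup G) (x : X.V) (B : ℕ)
    (hB : ∀ γ ∈ H, X.graph.dist x (X.smul γ x) ≤ B) : X.FixesVertex H := by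
  classical
  have hex : ∃ n, ∃ v, ∀ γ ∈ H, X.graph.dist v (X.smul γ x) ≤ n := ⟨B, x, hB⟩
  obtain ⟨v, hv⟩ := Nat.find_spec hex
  have hmin : ∀ w, ∃ γ ∈ H, Nat.find hex ≤ X.graph.dist w (X.smul γ x) := by
    intro w
    by_contra! hw
    have hpos : 0 < Nat.find hex := by
      have := hw 1 H.one_mem
      lia
    exact Nat.find_min hex (m := Nat.find hex - 1) (by lia) ⟨w, fun γ hγ => by
      have := hw γ hγ
      lia⟩
  have htr : ∀ δ ∈ H, ∀ γ ∈ H, X.graph.dist (X.smul δ v) (X.smul γ x) ≤ Nat.find hex := by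
    intro δ hδ γ hγ
    rw [← X.smul_inv_smul δ (X.smul γ x), X.dist_smul, ← X.smul_mul]
    exact hv _ (H.mul_mem (H.inv_mem hδ) hγ)
  have hle : ∀ δ ∈ H, X.graph.dist v (X.smul δ v) ≤ 1 := by
    intro δ hδ
    by_contra! h
    obtain ⟨γ, hγ, hle⟩ := hmin (X.graph.toward v (X.smul δ v))
    have h1 := X.isTree.dist_toward_lt_max h (X.smul γ x)
    exact absurd (hle.trans_lt (h1.trans_le (max_le (hv γ hγ) (htr δ hδ γ hγ)))) (lt_irrefl _)
  refine ⟨v, fun δ hδ => ?_⟩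
  by_contra hne
  have hadj : ∀ γ ∈ H, X.smul γ v ≠ v → X.graph.Adj v (X.smul γ v) := fun γ hγ hne => by
    have h1 := hle γ hγ
    have h2 := X.isTree.1.pos_dist_of_ne (Ne.symm hne)
    exact dist_eq_one_iff_adj.1 (by lia)
  have h1 := hadj δ hδ hne
  refine X.no_inversions δ v _ h1 ⟨rfl, ?_⟩
  by_contra h2
  rw [← X.smul_mul] at h2
  have h3 := hadj _ (H.mul_mem hδ hδ) h2
  have h4 := X.smul_adj δ h1
  rw [← X.smul_mul] at h4
  have h5 := X.isTree.dist_ne_of_adj v h4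
  rw [dist_eq_one_iff_adj.2 h1, dist_eq_one_iff_adj.2 h3] at h5
  exact h5 rfl

lemma sameElliptic_of_quasiIsometry {X Y : GTree G} {φ : X.V → Y.V}
    (hq : IsQuasiIsometry X Y φ) (he : CoarselyEquivariant X Y φ) :
    X.SameEllipticSubgroups Y := by
  obtain ⟨K, C, hK, hC, hqi, hsurj⟩ := hq
  obtain ⟨L, hL⟩ := he
  refine fun H => ⟨?_, ?_⟩
  · rintro ⟨x, hx⟩
    refine fixesVertex_of_bounded H (φ x) ⌈L⌉₊ fun γ hγ => ?_
    have := hL γ x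
    rw [hx γ hγ] at this
    exact_mod_cast this.le.trans (Nat.le_ceil L)
  · rintro ⟨y, hy⟩
    obtain ⟨x, hx⟩ := hsurj y
    refine fixesVertex_of_bounded H x ⌈K * (L + 2 * C + C)⌉₊ fun γ hγ => ?_
    have h1 := hL γ x
    have h2 : (Y.graph.dist (Y.smul γ (φ x)) y : ℝ) < C := by
      have := Y.dist_smul γ (φ x) y
      rw [hy γ hγ] at this
      rwa [this]
    have h3 := (hqi x (X.smul γ x)).1
    have h4 : Y.graph.dist (φ x) (φ (X.smul γ x)) ≤ Y.graph.dist (φ x) y +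
        (Y.graph.dist (Y.smul γ (φ x)) y +
          Y.graph.dist (φ (X.smul γ x)) (Y.smul γ (φ x))) := by
      have t1 : Y.graph.dist (φ x) (φ (X.smul γ x)) ≤ Y.graph.dist (φ x) y +
        Y.graph.dist y (φ (X.smul γ x)) := Y.isTree.1.dist_triangle
      have t2 : Y.graph.dist y (φ (X.smul γ x)) ≤ Y.graph.dist y (Y.smul γ (φ x)) +
        Y.graph.dist (Y.smul γ (φ x)) (φ (X.smul γ x)) := Y.isTree.1.dist_triangle
      rw [dist_comm (u := y) (v := Y.smul γ (φ x)),
        dist_comm (u := Y.smul γ (φ x)) (v := φ (X.smul γ x))] at t2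
      lia
    have h4' : (Y.graph.dist (φ x) (φ (X.smul γ x)) : ℝ) ≤ Y.graph.dist (φ x) y +
        (Y.graph.dist (Y.smul γ (φ x)) y +
          Y.graph.dist (φ (X.smul γ x)) (Y.smul γ (φ x))) := by exact_mod_cast h4
    have h5 : K⁻¹ * (X.graph.dist x (X.smul γ x) : ℝ) ≤ L + 2 * C + C := by linarith
    rw [inv_mul_le_iff₀ (by linarith)] at h5
    exact_mod_cast h5.trans (Nat.le_ceil _)

/-- Data for an equivariant expansion of `X`: a `G`-set `M` of new vertices, each pulled out of a
vertex of `X`, and for every edge `(u, a)` of `X` its new initial vertex, which is `u` or one of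
the vertices pulled out of `u`. -/
structure Splitting (X : GTree G) (M : Type u) [MulAction G M] where
  base : M → X.V
  base_smul : ∀ (γ : G) m, base (γ • m) = X.smul γ (base m)
  att : X.V → X.V → X.V ⊕ M
  base_att : ∀ u a, Sum.elim id base (att u a) = u
  att_smul : ∀ γ u a, att (X.smul γ u) (X.smul γ a) = Sum.map (X.smul γ) (γ • ·) (att u a)

namespace Splitting

variable {X : GTree G} {M : Type u} [MulAction G M] (S : Splitting X M)

/-- The map collapsing the new edges. -/
def proj : X.V ⊕ M → X.V := Sum.elim id S.base

@[simp] lemma proj_inl (x : X.V) : S.proj (.inl x) = x := rfl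

@[simp] lemma proj_inr (m : M) : S.proj (.inr m) = S.base m := rfl

@[simp] lemma proj_att (u a : X.V) : S.proj (S.att u a) = u := S.base_att u a

lemma proj_smul (γ : G) (z : X.V ⊕ M) :
    S.proj (Sum.map (X.smul γ) (γ • ·) z) = X.smul γ (S.proj z) := by
  cases z with
  | inl x => rfl
  | inr m => exact S.base_smul γ m

/-- The expanded graph. -/
def graph : SimpleGraph (X.V ⊕ M) where
  Adj z z' := (X.graph.Adj (S.proj z) (S.proj z') ∧ z = S.att (S.proj z) (S.proj z') ∧
      z' = S.att (S.proj z') (S.proj z)) ∨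
    (∃ m, z = .inl (S.base m) ∧ z' = .inr m) ∨ ∃ m, z = .inr m ∧ z' = .inl (S.base m)
  symm := ⟨by
    rintro z z' (⟨h1, h2, h3⟩ | ⟨m, h1, h2⟩ | ⟨m, h1, h2⟩)
    · exact .inl ⟨h1.symm, h3, h2⟩
    · exact .inr (.inr ⟨m, h2, h1⟩)
    · exact .inr (.inl ⟨m, h2, h1⟩)⟩
  loopless := ⟨by
    rintro z (⟨h1, -⟩ | ⟨m, rfl, h2⟩ | ⟨m, rfl, h2⟩)
    · exact h1.ne rfl
    · cases h2
    · cases h2⟩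

lemma adj_att {u a : X.V} (h : X.graph.Adj u a) : S.graph.Adj (S.att u a) (S.att a u) :=
  .inl (by simpa using h)

lemma adj_base (m : M) : S.graph.Adj (.inr m) (.inl (S.base m)) := .inr (.inr ⟨m, rfl, rfl⟩)

lemma eq_or_adj_proj (z : X.V ⊕ M) : z = .inl (S.proj z) ∨ S.graph.Adj z (.inl (S.proj z)) := by
  cases z with
  | inl x => exact .inl rfl
  | inr m => exact .inr (S.adj_base m)

lemma reachable_proj (z : X.V ⊕ M) : S.graph.Reachable z (.inl (S.proj z)) := by
  rcases S.eq_or_adj_proj z with h | h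
  · rw [← h]
  · exact h.reachable

lemma connected : S.graph.Connected := by
  have hne := X.isTree.1.nonempty
  have key : ∀ x y : X.V, S.graph.Reachable (.inl x) (.inl y) := by
    intro x y
    obtain ⟨w⟩ := X.isTree.1 x y
    induction w with
    | nil => exact .rfl
    | @cons a b c h w ih =>
      refine .trans ?_ ih
      have h1 := S.reachable_proj (S.att a b)
      have h2 := S.reachable_proj (S.att b a)
      rw [proj_att] at h1 h2
      exact h1.symm.trans ((S.adj_att h).reachable.trans h2)
  have : Nonempty (X.V ⊕ M) := hne.map .inl
  exact ⟨fun z z' => (S.reachable_proj z).trans ((key _ _).trans (S.reachable_proj z').symm)⟩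

lemma exists_cut_base (m : M) : ∃ D : Set (X.V ⊕ M), .inr m ∈ D ∧ .inl (S.base m) ∉ D ∧
    ∀ x y, S.graph.Adj x y → x ∈ D → y ∉ D → x = .inr m ∧ y = .inl (S.base m) := by
  refine ⟨{z | z = .inr m ∨ (S.proj z ≠ S.base m ∧
    S.att (S.base m) (X.graph.toward (S.base m) (S.proj z)) = .inr m)}, .inl rfl, by simp, ?_⟩
  rintro x y (⟨h1, h2, h3⟩ | ⟨m', rfl, rfl⟩ | ⟨m', rfl, rfl⟩) hx hy
  · exfalso
    apply hy
    rcases hx with rfl | ⟨hx1, hx2⟩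
    · refine .inr ⟨h1.ne', ?_⟩
      rw [proj_inr] at h1 h2
      rw [X.isTree.toward_of_adj h1, ← h2]
    · by_cases hyu : S.proj y = S.base m
      · left
        rw [hyu] at h3 h1
        rwa [h3, ← X.isTree.toward_of_adj h1.symm]
      · exact .inr ⟨hyu, by rwa [← X.isTree.toward_eq_toward_of_adj h1 hx1 hyu]⟩
  · rcases hx with hx | hx
    · cases hx
    · exact absurd (.inr hx) hy
  · rcases hx with hx | hx
    · cases hx
      exact ⟨rfl, rfl⟩
    · exact absurd (.inr hx) hy

lemma exists_cut {z z' : X.V ⊕ M} (h : S.graph.Adj z z') : ∃ D : Set (X.V ⊕ M), z ∈ D ∧ z' ∉ D ∧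
    ∀ x y, S.graph.Adj x y → x ∈ D → y ∉ D → x = z ∧ y = z' := by
  rcases h with ⟨h1, h2, h3⟩ | ⟨m, rfl, rfl⟩ | ⟨m, rfl, rfl⟩
  · refine ⟨{x | X.graph.dist (S.proj x) (S.proj z) < X.graph.dist (S.proj x) (S.proj z')},
      ?_, ?_, ?_⟩
    · simp [dist_eq_one_iff_adj.2 h1]
    · simp
    · rintro x y (⟨h4, h5, h6⟩ | ⟨m, rfl, rfl⟩ | ⟨m, rfl, rfl⟩) hx hy
      · obtain ⟨h7, h8⟩ := X.isTree.eq_of_adj_of_dist_lt h1 h4 hx hy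
        rw [h7, h8] at h5 h6
        exact ⟨h5.trans h2.symm, h6.trans h3.symm⟩
      · exact absurd hx hy
      · exact absurd hx hy
  · obtain ⟨D, h1, h2, h3⟩ := S.exists_cut_base m
    refine ⟨Dᶜ, h2, not_not.2 h1, fun x y hxy hx hy => ?_⟩
    exact (h3 y x hxy.symm (not_not.1 hy) hx).symm
  · exact S.exists_cut_base m

/-- The expanded tree. -/
def expand : GTree G where
  V := X.V ⊕ M
  graph := S.graph
  isTree := isTree_of_cuts S.connected fun _ _ h => S.exists_cut h
  smul γ := Sum.map (X.smul γ) (γ • ·)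
  smul_one := by
    rintro (x | m)
    · simp [X.smul_one]
    · simp
  smul_mul := by
    rintro γ δ (x | m)
    · simp [X.smul_mul]
    · simp [mul_smul]
  smul_adj := by
    rintro γ x y (⟨h1, h2, h3⟩ | ⟨m, rfl, rfl⟩ | ⟨m, rfl, rfl⟩)
    · refine .inl ⟨?_, ?_, ?_⟩
      · simpa only [S.proj_smul] using X.smul_adj γ h1
      · rw [S.proj_smul, S.proj_smul, S.att_smul, ← h2]
      · rw [S.proj_smul, S.proj_smul, S.att_smul, ← h3]
    · exact .inr (.inl ⟨γ • m, by simp [S.base_smul], rfl⟩)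
    · exact .inr (.inr ⟨γ • m, rfl, by simp [S.base_smul]⟩)
  no_inversions := by
    rintro γ x y (⟨h1, -, -⟩ | ⟨m, rfl, rfl⟩ | ⟨m, rfl, rfl⟩) ⟨h4, h5⟩
    · exact X.no_inversions γ _ _ h1 ⟨by rw [← S.proj_smul, h4], by rw [← S.proj_smul, h5]⟩
    · cases h4
    · cases h4

lemma isCollapse (m₀ : M) (hM : ∀ m : M, ∃ γ : G, γ • m₀ = m) :
    IsCollapse S.expand X S.proj ⟨(.inr m₀, .inl (S.base m₀)), S.adj_base m₀⟩ := by
  refine ⟨inf_eq_left.2 fun γ hγ => ?_, fun γ h => ?_, fun x => ⟨.inl x, rfl⟩, S.proj_smul,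
    fun u v => ⟨fun h => ?_, fun h => ?_⟩, fun a b hab => ⟨fun h => ?_, ?_⟩⟩
  · have h1 : γ • m₀ = m₀ := Sum.inr_injective (mem_stab.1 hγ)
    change Sum.inl (X.smul γ (S.base m₀)) = Sum.inl (S.base m₀)
    rw [← S.base_smul, h1]
  · cases h
  · have key : ∀ z : X.V ⊕ M, Relation.EqvGen (fun a b : S.expand.V => ∃ γ : G,
        a = S.expand.smul γ (.inr m₀) ∧ b = S.expand.smul γ (.inl (S.base m₀)))
        z (.inl (S.proj z)) := by
      rintro (x | m)
      · exact .refl _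
      · obtain ⟨γ, rfl⟩ := hM m
        refine .rel _ _ ⟨γ, rfl, ?_⟩
        rw [proj_inr, S.base_smul]
        rfl
    exact (key u).trans _ _ _ (h ▸ (key v).symm)
  · induction h with
    | rel a b h =>
      obtain ⟨γ, rfl, rfl⟩ := h
      exact S.base_smul γ m₀
    | refl => rfl
    | symm _ _ _ ih => exact ih.symm
    | trans _ _ _ _ _ ih ih' => exact ih.trans ih'
  · exact ⟨_, _, S.adj_att h, S.proj_att _ _, S.proj_att _ _⟩
  · rintro ⟨u, v, h1 | ⟨m, rfl, rfl⟩ | ⟨m, rfl, rfl⟩, rfl, rfl⟩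
    · exact h1.1
    · exact absurd rfl hab
    · exact absurd rfl hab

lemma finite_vquot_expand (hX : Finite X.VQuot) (m₀ : M) (hM : ∀ m : M, ∃ γ : G, γ • m₀ = m) :
    Finite S.expand.VQuot := by
  have := hX
  refine Finite.of_surjective (α := Option X.VQuot)
    (fun o => o.elim (VQuot.mk (X := S.expand) (.inr m₀))
      (Quot.lift (fun x => VQuot.mk (X := S.expand) (.inl x)) ?_)) ?_
  · rintro x _ ⟨γ, rfl⟩
    exact VQuot.mk_eq_iff.2 ⟨γ, rfl⟩
  · intro q
    obtain ⟨x | m, rfl⟩ := VQuot.mk_surjective q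
    · exact ⟨some (VQuot.mk x), rfl⟩
    · obtain ⟨γ, rfl⟩ := hM m
      exact ⟨none, VQuot.mk_eq_iff.2 ⟨γ, rfl⟩⟩

end Splitting

/-- A `G`-equivariant isomorphism is an elementary deformation: attach a leaf and collapse it. -/
lemma IsGIso.elemDeformation {X Y : GTree G} {φ : X.V → Y.V} (h : IsGIso X Y φ) :
    ElemDeformation X Y := by
  obtain ⟨⟨hinj, hsurj⟩, hadj, heq⟩ := h
  obtain ⟨x₀⟩ := X.isTree.1.nonempty
  let S : Splitting X G :=
    { base := fun γ => X.smul γ x₀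
      base_smul := fun γ δ => X.smul_mul γ δ x₀
      att := fun u _ => .inl u
      base_att := fun _ _ => rfl
      att_smul := fun _ _ _ => rfl }
  have h1 := S.isCollapse 1 fun γ => ⟨γ, mul_one γ⟩
  have h2 : Collapse S.expand Y := by
    refine ⟨φ ∘ S.proj, _, h1.1, h1.2.1, hsurj.comp h1.2.2.1, fun γ x => ?_, fun u v => ?_,
      fun a b hab => ?_⟩
    · change φ (S.proj _) = _
      rw [h1.2.2.2.1, heq]
      rfl
    · rw [← h1.2.2.2.2.1]
      exact hinj.eq_iff
    · obtain ⟨x, rfl⟩ := hsurj a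
      obtain ⟨y, rfl⟩ := hsurj b
      rw [← hadj, h1.2.2.2.2.2 x y fun h => hab (h ▸ rfl)]
      simp only [Function.comp, hinj.eq_iff]
  exact .trans _ _ _ (.symm _ _ (.rel _ _ ⟨_, _, h1⟩)) (.rel _ _ h2)

section Collapse

variable (X : GTree G) {a b : X.V} (hab : X.graph.Adj a b) (hne : ∀ γ, X.smul γ a ≠ b)

open Classical in
/-- The retraction onto the complement of the orbit of `a` which sends `γ a` to `γ b`. -/
noncomputable def retract (hne : ∀ γ, X.smul γ a ≠ b) (v : X.V) :
    { v : X.V // ∀ γ, X.smul γ a ≠ v } :=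
  if h : ∃ γ, X.smul γ a = v then
    ⟨X.smul h.choose b, fun δ hδ => hne (h.choose⁻¹ * δ) (by
      rw [X.smul_mul, hδ, X.inv_smul_smul])⟩
  else ⟨v, not_exists.1 h⟩

lemma retract_of_forall_ne {v : X.V} (h : ∀ γ, X.smul γ a ≠ v) : X.retract hne v = ⟨v, h⟩ := by
  rw [retract, dif_neg (not_exists.2 h)]

lemma retract_smul_left (hst : X.stab a ≤ X.stab b) (γ : G) :
    (X.retract hne (X.smul γ a)).1 = X.smul γ b := by
  have h : ∃ δ, X.smul δ a = X.smul γ a := ⟨γ, rfl⟩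
  rw [retract, dif_pos h]
  have h1 : γ⁻¹ * h.choose ∈ X.stab a := by
    rw [mem_stab, X.smul_mul, h.choose_spec, X.inv_smul_smul]
  have h2 := mem_stab.1 (hst h1)
  rw [X.smul_mul] at h2
  change X.smul h.choose b = _
  conv_rhs => rw [← h2]
  rw [X.smul_inv_smul]

lemma retract_val (v : { v : X.V // ∀ γ, X.smul γ a ≠ v }) : X.retract hne v.1 = v :=
  X.retract_of_forall_ne hne v.2

/-- The action on the complement of an orbit. -/
def complSMul (a : X.V) (γ : G) (v : { v : X.V // ∀ γ, X.smul γ a ≠ v }) :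
    { v : X.V // ∀ γ, X.smul γ a ≠ v } :=
  ⟨X.smul γ v.1, fun δ hδ => v.2 (γ⁻¹ * δ) (by rw [X.smul_mul, hδ, X.inv_smul_smul])⟩

lemma retract_smul (hst : X.stab a ≤ X.stab b) (γ : G) (v : X.V) :
    X.retract hne (X.smul γ v) = X.complSMul a γ (X.retract hne v) := by
  by_cases h : ∃ δ, X.smul δ a = v
  · obtain ⟨δ, rfl⟩ := h
    apply Subtype.ext
    rw [← X.smul_mul, X.retract_smul_left hne hst]
    change _ = X.smul γ (X.retract hne _).1
    rw [X.retract_smul_left hne hst, X.smul_mul]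
  · rw [not_exists] at h
    rw [X.retract_of_forall_ne hne h]
    exact X.retract_val hne (X.complSMul a γ ⟨v, h⟩)

/-- The graph obtained by collapsing the orbit of the edge from `a` to `b`. -/
def collapseGraph (hne : ∀ γ, X.smul γ a ≠ b) : SimpleGraph { v : X.V // ∀ γ, X.smul γ a ≠ v } where
  Adj w w' := w ≠ w' ∧ ∃ u u', X.graph.Adj u u' ∧ X.retract hne u = w ∧ X.retract hne u' = w'
  symm := ⟨fun _ _ ⟨h, u, u', h1, h2, h3⟩ => ⟨h.symm, u', u, h1.symm, h3, h2⟩⟩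
  loopless := ⟨fun _ h => h.1 rfl⟩

lemma collapseGraph_adj_retract {u u' : X.V} (h : X.graph.Adj u u')
    (hr : X.retract hne u ≠ X.retract hne u') :
    (X.collapseGraph hne).Adj (X.retract hne u) (X.retract hne u') :=
  ⟨hr, u, u', h, rfl, rfl⟩

lemma collapseGraph_connected : (X.collapseGraph hne).Connected := by
  have : Nonempty { v : X.V // ∀ γ, X.smul γ a ≠ v } := ⟨⟨b, hne⟩⟩
  have key : ∀ x y, (X.collapseGraph hne).Reachable (X.retract hne x) (X.retract hne y) := by
    intro x y
    obtain ⟨p⟩ := X.isTree.1 x y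
    induction p with
    | nil => exact .rfl
    | @cons x y z h p ih =>
      refine .trans ?_ ih
      by_cases hr : X.retract hne x = X.retract hne y
      · rw [hr]
      · exact (X.collapseGraph_adj_retract hne h hr).reachable
  refine ⟨fun w w' => ?_⟩
  rw [← X.retract_val hne w, ← X.retract_val hne w']
  exact key _ _

include hab in
/-- Half-spaces of surviving edges are unions of fibres of the retraction. -/
lemma dist_lt_iff_retract (hst : X.stab a ≤ X.stab b) {p q : X.V} (hpq : X.graph.Adj p q)
    (hr : X.retract hne p ≠ X.retract hne q) (v : X.V) :
    X.graph.dist (X.retract hne v).1 p < X.graph.dist (X.retract hne v).1 q ↔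
      X.graph.dist v p < X.graph.dist v q := by
  by_cases h : ∃ δ, X.smul δ a = v
  · obtain ⟨δ, rfl⟩ := h
    have h1 : X.retract hne (X.smul δ a) = X.retract hne (X.smul δ b) := by
      apply Subtype.ext
      rw [X.retract_smul_left hne hst, X.retract_of_forall_ne]
      exact fun γ h => hne (δ⁻¹ * γ) (by rw [X.smul_mul, h, X.inv_smul_smul])
    have hadj := X.smul_adj δ hab
    rw [X.retract_smul_left hne hst]
    by_contra hcon
    rw [not_iff] at hcon
    by_cases hd : X.graph.dist (X.smul δ a) p < X.graph.dist (X.smul δ a) q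
    · obtain ⟨h2, h3⟩ := X.isTree.eq_of_adj_of_dist_lt hpq hadj hd (hcon.2 hd)
      exact hr (by rw [← h2, ← h3, h1])
    · have hd' : X.graph.dist (X.smul δ b) p < X.graph.dist (X.smul δ b) q := by
        by_contra h
        exact hd (hcon.1 h)
      obtain ⟨h2, h3⟩ := X.isTree.eq_of_adj_of_dist_lt hpq hadj.symm hd' hd
      exact hr (by rw [← h2, ← h3, h1])
  · rw [X.retract_of_forall_ne hne (not_exists.1 h)]

include hab in
lemma collapseGraph_cut (hst : X.stab a ≤ X.stab b) {p q : X.V} (hpq : X.graph.Adj p q)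
    (hr : X.retract hne p ≠ X.retract hne q) {u v : X.V} (huv : X.graph.Adj u v)
    (hu : X.graph.dist (X.retract hne u).1 p < X.graph.dist (X.retract hne u).1 q)
    (hv : ¬ X.graph.dist (X.retract hne v).1 p < X.graph.dist (X.retract hne v).1 q) :
    u = p ∧ v = q := by
  rw [X.dist_lt_iff_retract hab hne hst hpq hr] at hu hv
  exact X.isTree.eq_of_adj_of_dist_lt hpq huv hu hv

include hab in
lemma dist_retract_endpoints (hst : X.stab a ≤ X.stab b) {p q : X.V} (hpq : X.graph.Adj p q)
    (hr : X.retract hne p ≠ X.retract hne q) :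
    X.graph.dist (X.retract hne p).1 p < X.graph.dist (X.retract hne p).1 q ∧
    ¬ X.graph.dist (X.retract hne q).1 p < X.graph.dist (X.retract hne q).1 q := by
  rw [X.dist_lt_iff_retract hab hne hst hpq hr, X.dist_lt_iff_retract hab hne hst hpq hr]
  simp [dist_eq_one_iff_adj.2 hpq]

/-- The tree obtained by collapsing the orbit of the edge from `a` to `b`. -/
def collapse (hst : X.stab a ≤ X.stab b) : GTree G where
  V := { v : X.V // ∀ γ, X.smul γ a ≠ v }
  graph := X.collapseGraph hne
  isTree := isTree_of_cuts (X.collapseGraph_connected hne) (by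
    rintro _ _ ⟨hr, p, q, hpq, rfl, rfl⟩
    obtain ⟨h1, h2⟩ := X.dist_retract_endpoints hab hne hst hpq hr
    refine ⟨{w | X.graph.dist w.1 p < X.graph.dist w.1 q}, h1, h2, ?_⟩
    rintro _ _ ⟨-, u, v, huv, rfl, rfl⟩ hx hy
    obtain ⟨rfl, rfl⟩ := X.collapseGraph_cut hab hne hst hpq hr huv hx hy
    exact ⟨rfl, rfl⟩)
  smul := X.complSMul a
  smul_one v := Subtype.ext (X.smul_one v.1)
  smul_mul γ δ v := Subtype.ext (X.smul_mul γ δ v.1)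
  smul_adj := by
    rintro γ _ _ ⟨hr, p, q, hpq, rfl, rfl⟩
    rw [← X.retract_smul hne hst, ← X.retract_smul hne hst]
    refine X.collapseGraph_adj_retract hne (X.smul_adj γ hpq) ?_
    rw [X.retract_smul hne hst, X.retract_smul hne hst]
    intro h
    exact hr (Subtype.ext (X.smul_injective γ (congrArg Subtype.val h)))
  no_inversions := by
    rintro γ _ _ ⟨hr, p, q, hpq, rfl, rfl⟩ ⟨h1, h2⟩
    obtain ⟨h3, h4⟩ := X.dist_retract_endpoints hab hne hst hpq hr
    rw [← h2, ← X.retract_smul hne hst] at h3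
    rw [← h1, ← X.retract_smul hne hst] at h4
    obtain ⟨h5, h6⟩ := X.collapseGraph_cut hab hne hst hpq hr (X.smul_adj γ hpq.symm) h3 h4
    exact X.no_inversions γ p q hpq ⟨h6, h5⟩

lemma isCollapse_retract (hst : X.stab a ≤ X.stab b) :
    IsCollapse X (X.collapse hab hne hst) (X.retract hne) ⟨(a, b), hab⟩ := by
  refine ⟨inf_eq_left.2 hst, hne, fun w => ⟨w.1, X.retract_val hne w⟩, X.retract_smul hne hst,
    fun u v => ⟨fun h => ?_, fun h => ?_⟩, fun w w' hw => ⟨fun h => h.2, ?_⟩⟩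
  · have key : ∀ v : X.V, Relation.EqvGen (fun x y : X.V => ∃ γ : G,
        x = X.smul γ a ∧ y = X.smul γ b) v (X.retract hne v).1 := by
      intro v
      by_cases h : ∃ δ, X.smul δ a = v
      · obtain ⟨δ, rfl⟩ := h
        rw [X.retract_smul_left hne hst]
        exact .rel _ _ ⟨δ, rfl, rfl⟩
      · rw [X.retract_of_forall_ne hne (not_exists.1 h)]
        exact .refl _
    exact (key u).trans _ _ _ (h ▸ (key v).symm)
  · induction h with
    | rel x y h =>
      obtain ⟨γ, rfl, rfl⟩ := h
      apply Subtype.ext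
      change (X.retract hne (X.smul γ a)).1 = (X.retract hne (X.smul γ b)).1
      rw [X.retract_smul_left hne hst, X.retract_of_forall_ne]
      exact fun δ h => hne (γ⁻¹ * δ) (by rw [X.smul_mul, h, X.inv_smul_smul])
    | refl => rfl
    | symm _ _ _ ih => exact ih.symm
    | trans _ _ _ _ _ ih ih' => exact ih.trans ih'
  · rintro ⟨u, v, huv, rfl, rfl⟩
    exact X.collapseGraph_adj_retract hne huv hw

lemma card_vquot_collapse (hst : X.stab a ≤ X.stab b) (hX : Finite X.VQuot) :
    Finite (X.collapse hab hne hst).VQuot ∧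
      Nat.card (X.collapse hab hne hst).VQuot < Nat.card X.VQuot := by
  let i : (X.collapse hab hne hst).VQuot → X.VQuot :=
    Quot.lift (fun v => VQuot.mk v.1) (by
      rintro v _ ⟨γ, rfl⟩
      exact VQuot.mk_eq_iff.2 ⟨γ, rfl⟩)
  have hi : Function.Injective i := by
    intro q q' h
    obtain ⟨v, rfl⟩ := VQuot.mk_surjective q
    obtain ⟨v', rfl⟩ := VQuot.mk_surjective q'
    obtain ⟨γ, hγ⟩ := VQuot.mk_eq_iff.1 h
    exact VQuot.mk_eq_iff.2 ⟨γ, Subtype.ext hγ⟩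
  refine ⟨Finite.of_injective i hi, ?_⟩
  by_contra hle
  obtain ⟨q, hq⟩ := (hi.bijective_of_nat_card_le (not_lt.1 hle)).2 (VQuot.mk a)
  obtain ⟨v, rfl⟩ := VQuot.mk_surjective q
  obtain ⟨γ, hγ⟩ := VQuot.mk_eq_iff.1 hq.symm
  exact v.2 γ hγ

end Collapse

/-- `Reach f x z n`: there is a path from `x` to `z` whose edges have total length at most `n`
when measured along `f`. -/
inductive Reach {X Y : GTree G} (f : X.V → Y.V) : X.V → X.V → ℕ → Prop
  | nil (x : X.V) (n : ℕ) : Reach f x x n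
  | cons {x y z : X.V} {m n : ℕ} (h : X.graph.Adj x y) (p : Reach f y z n)
      (hm : Y.graph.dist (f x) (f y) + n ≤ m) : Reach f x z m

namespace Reach

variable {X X' Y : GTree G} {f : X.V → Y.V}

lemma mono {x z : X.V} {m n : ℕ} (h : Reach f x z m) (hmn : m ≤ n) : Reach f x z n := by
  cases h with
  | nil => exact .nil _ _
  | cons h p hm => exact .cons h p (hm.trans hmn)

lemma of_adj {x y : X.V} (h : X.graph.Adj x y) : Reach f x y (Y.graph.dist (f x) (f y)) :=
  .cons h (.nil y 0) le_rfl

lemma trans {x y z : X.V} {m n : ℕ} (h : Reach f x y m) (h' : Reach f y z n) :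
    Reach f x z (m + n) := by
  induction h with
  | nil => exact h'.mono (by lia)
  | cons h _ hm ih => exact .cons h (ih h') (by lia)

lemma map {f' : X'.V → Y.V} (F : X.V → X'.V)
    (hF : ∀ x y, X.graph.Adj x y → Reach f' (F x) (F y) (Y.graph.dist (f x) (f y)))
    {x z : X.V} {n : ℕ} (h : Reach f x z n) : Reach f' (F x) (F z) n := by
  induction h with
  | nil => exact .nil _ _
  | cons h _ hm ih => exact ((hF _ _ h).trans ih).mono hm

lemma dist_le {x z : X.V} {n : ℕ} (h : Reach f x z n) : Y.graph.dist (f x) (f z) ≤ n := by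
  induction h with
  | nil => simp
  | cons _ _ hm ih => exact Y.isTree.1.dist_triangle.trans ((Nat.add_le_add_left ih _).trans hm)

lemma exists_of_tree (f : X.V → Y.V) (x z : X.V) : ∃ n, Reach f x z n := by
  obtain ⟨w⟩ := X.isTree.1 x z
  induction w with
  | nil => exact ⟨0, .nil _ _⟩
  | cons h _ ih =>
    obtain ⟨n, hn⟩ := ih
    exact ⟨_, .cons h hn le_rfl⟩

lemma eq_of_zero (hno : ∀ x y, X.graph.Adj x y → f x ≠ f y) {x z : X.V} (h : Reach f x z 0) :
    x = z := by
  cases h with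
  | nil => rfl
  | cons h _ hm =>
    have := Y.isTree.1.pos_dist_of_ne (hno _ _ h)
    lia

lemma adj_of_one (hno : ∀ x y, X.graph.Adj x y → f x ≠ f y) {x z : X.V} (h : Reach f x z 1)
    (hxz : x ≠ z) : X.graph.Adj x z := by
  cases h with
  | nil => exact absurd rfl hxz
  | cons h p hm =>
    have := Y.isTree.1.pos_dist_of_ne (hno _ _ h)
    rwa [← (p.mono (by lia)).eq_of_zero hno]

/-- A path either maps to a geodesic or makes a turn at which its image backtracks. -/
lemma geodesic_or_turn (hno : ∀ x y, X.graph.Adj x y → f x ≠ f y) {x z : X.V} {n : ℕ}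
    (h : Reach f x z n) : Reach f x z (Y.graph.dist (f x) (f z)) ∨
      ∃ a u b n₁ n₂, Reach f x a n₁ ∧ X.graph.Adj a u ∧ X.graph.Adj u b ∧ Reach f b z n₂ ∧
        n₁ + Y.graph.dist (f a) (f u) + Y.graph.dist (f u) (f b) + n₂ ≤ n ∧
        Y.graph.toward (f u) (f a) = Y.graph.toward (f u) (f b) := by
  suffices H : (x = z ∨ ∃ y k, X.graph.Adj x y ∧ Reach f y z k ∧
      Y.graph.dist (f x) (f y) + k = Y.graph.dist (f x) (f z)) ∨
      ∃ a u b n₁ n₂, Reach f x a n₁ ∧ X.graph.Adj a u ∧ X.graph.Adj u b ∧ Reach f b z n₂ ∧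
        n₁ + Y.graph.dist (f a) (f u) + Y.graph.dist (f u) (f b) + n₂ ≤ n ∧
        Y.graph.toward (f u) (f a) = Y.graph.toward (f u) (f b) by
    rcases H with (rfl | ⟨y, k, h1, h2, h3⟩) | H
    · exact .inl (.nil _ _)
    · exact .inl (.cons h1 h2 h3.le)
    · exact .inr H
  induction h with
  | nil => exact .inl (.inl rfl)
  | @cons x y z m n h p hm ih =>
    rcases ih with (rfl | ⟨b, k, h1, h2, h3⟩) | ⟨a, u, b, n₁, n₂, h1, h2, h3, h4, h5, h6⟩
    · exact .inl (.inr ⟨y, 0, h, .nil _ _, rfl⟩)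
    · by_cases ht : Y.graph.toward (f y) (f x) = Y.graph.toward (f y) (f b)
      · have := p.dist_le
        exact .inr ⟨x, y, b, 0, k, .nil _ _, h, h1, h2, by lia, ht⟩
      · left; right
        have hpos := Y.isTree.1.pos_dist_of_ne (hno _ _ h1)
        have hk := h2.dist_le
        have htri : Y.graph.dist (f y) (f z) ≤ Y.graph.dist (f y) (f b) +
          Y.graph.dist (f b) (f z) := Y.isTree.1.dist_triangle
        have hzy : f z ≠ f y := fun h => by
          rw [h, dist_self] at h3
          lia
        have := Y.isTree.toward_eq_of_between (hno _ _ h1)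
          (show Y.graph.dist (f y) (f b) + Y.graph.dist (f b) (f z) = _ by lia)
        refine ⟨y, _, h, .cons h1 h2 h3.le, ?_⟩
        rw [Y.isTree.dist_add_of_toward_ne (p := f x) hzy (by rwa [← this])]
    · exact .inr ⟨a, u, b, _, n₂, .cons h h1 le_rfl, h2, h3, h4, by lia, h6⟩

end Reach

/-- The orbit of a pair of vertices. -/
def PairOrbit (X Y : GTree G) (x : X.V) (y : Y.V) : Type u :=
  { p : X.V × Y.V // ∃ γ, (X.smul γ x, Y.smul γ y) = p }

namespace PairOrbit

variable {X Y : GTree G} {x : X.V} {y : Y.V}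

instance : MulAction G (PairOrbit X Y x y) where
  smul γ p := ⟨(X.smul γ p.1.1, Y.smul γ p.1.2), by
    obtain ⟨_, δ, rfl⟩ := p
    exact ⟨γ * δ, by rw [X.smul_mul, Y.smul_mul]⟩⟩
  one_smul p := Subtype.ext (Prod.ext (X.smul_one _) (Y.smul_one _))
  mul_smul γ δ p := Subtype.ext (Prod.ext (X.smul_mul γ δ _) (Y.smul_mul γ δ _))

/-- The base point of the orbit. -/
def pt (x : X.V) (y : Y.V) : PairOrbit X Y x y :=
  ⟨(x, y), 1, by rw [X.smul_one, Y.smul_one]⟩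

lemma exists_smul_pt (p : PairOrbit X Y x y) : ∃ γ : G, γ • pt x y = p := by
  obtain ⟨_, γ, rfl⟩ := p
  exact ⟨γ, rfl⟩

lemma smul_mem_iff (γ : G) (x' : X.V) (y' : Y.V) :
    (∃ δ, (X.smul δ x, Y.smul δ y) = (X.smul γ x', Y.smul γ y')) ↔
      ∃ δ, (X.smul δ x, Y.smul δ y) = (x', y') := by
  simp only [Prod.mk.injEq]
  constructor
  · rintro ⟨δ, h1, h2⟩
    exact ⟨γ⁻¹ * δ, by rw [X.smul_mul, h1, X.inv_smul_smul], by
      rw [Y.smul_mul, h2, Y.inv_smul_smul]⟩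
  · rintro ⟨δ, rfl, rfl⟩
    exact ⟨γ * δ, X.smul_mul _ _ _, Y.smul_mul _ _ _⟩

open Classical in
/-- The new vertex `(x', y')` if it exists, and `x'` otherwise. -/
noncomputable def lift (x : X.V) (y : Y.V) (x' : X.V) (y' : Y.V) : X.V ⊕ PairOrbit X Y x y :=
  if h : ∃ γ, (X.smul γ x, Y.smul γ y) = (x', y') then .inr ⟨(x', y'), h⟩ else .inl x'

lemma lift_cases (x' : X.V) (y' : Y.V) :
    (∃ h, lift x y x' y' = .inr ⟨(x', y'), h⟩) ∨
      (¬ (∃ γ, (X.smul γ x, Y.smul γ y) = (x', y')) ∧ lift x y x' y' = .inl x') := by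
  by_cases h : ∃ γ, (X.smul γ x, Y.smul γ y) = (x', y')
  · exact .inl ⟨h, dif_pos h⟩
  · exact .inr ⟨h, dif_neg h⟩

lemma lift_self : lift x y x y = .inr (pt x y) :=
  dif_pos ⟨1, by rw [X.smul_one, Y.smul_one]⟩

lemma lift_smul (γ : G) (x' : X.V) (y' : Y.V) :
    lift x y (X.smul γ x') (Y.smul γ y') = Sum.map (X.smul γ) (γ • ·) (lift x y x' y') := by
  by_cases h : ∃ γ, (X.smul γ x, Y.smul γ y) = (x', y')
  · rw [lift, lift, dif_pos ((smul_mem_iff γ x' y').2 h), dif_pos h]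
    rfl
  · rw [lift, lift, dif_neg (mt (smul_mem_iff γ x' y').1 h), dif_neg h]
    rfl

end PairOrbit

/-- The splitting attaching a leaf `(γ x, γ y)` at every `γ x`. -/
def leafSplitting (X Y : GTree G) (x : X.V) (y : Y.V) : Splitting X (PairOrbit X Y x y) where
  base p := p.1.1
  base_smul _ _ := rfl
  att u _ := .inl u
  base_att _ _ := rfl
  att_smul _ _ _ := rfl

/-- The splitting folding together the edges at `u` whose images under `f` begin with the edge
from `f u` to `c`. -/
noncomputable def foldSplitting {X Y : GTree G} {f : X.V → Y.V} (hf : Equivariant X Y f) (u : X.V)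
    (c : Y.V) : Splitting X (PairOrbit X Y u c) where
  base p := p.1.1
  base_smul _ _ := rfl
  att x a := PairOrbit.lift u c x (Y.graph.toward (f x) (f a))
  base_att x a := by
    rcases PairOrbit.lift_cases (x := u) (y := c) x (Y.graph.toward (f x) (f a)) with
      ⟨_, h⟩ | ⟨_, h⟩ <;> rw [h] <;> rfl
  att_smul γ x a := by rw [hf, hf, ← Y.smul_toward, PairOrbit.lift_smul]

lemma Splitting.elemDeformation_expand {X Y : GTree G} {x : X.V} {y : Y.V}
    (S : Splitting X (PairOrbit X Y x y)) : ElemDeformation X S.expand :=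
  .symm _ _ (.rel _ _ ⟨_, _, S.isCollapse (.pt x y) PairOrbit.exists_smul_pt⟩)

/-- The extension of an equivariant map to new vertices which are labelled by vertices of `Y`. -/
def extendMap {X Y : GTree G} (f : X.V → Y.V) (x : X.V) (y : Y.V) :
    X.V ⊕ PairOrbit X Y x y → Y.V := Sum.elim f fun p => p.1.2

lemma extendMap_lift {X Y : GTree G} (f : X.V → Y.V) (x : X.V) (y : Y.V) (x' : X.V) (y' : Y.V) :
    ((∃ γ, (X.smul γ x, Y.smul γ y) = (x', y')) ∧
      extendMap f x y (PairOrbit.lift x y x' y') = y') ∨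
    ((¬ ∃ γ, (X.smul γ x, Y.smul γ y) = (x', y')) ∧
      extendMap f x y (PairOrbit.lift x y x' y') = f x') := by
  rcases PairOrbit.lift_cases (x := x) (y := y) x' y' with ⟨h, h'⟩ | ⟨h, h'⟩
  · exact .inl ⟨h, by rw [h']; rfl⟩
  · exact .inr ⟨h, by rw [h']; rfl⟩

lemma Equivariant.extendMap {X Y : GTree G} {f : X.V → Y.V} (hf : Equivariant X Y f) {x : X.V}
    {y : Y.V} (S : Splitting X (PairOrbit X Y x y)) :
    Equivariant S.expand Y (GTree.extendMap f x y) := by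
  rintro γ (v | p)
  · exact hf γ v
  · rfl

section Fold

variable {X Y : GTree G} {f : X.V → Y.V} (hf : Equivariant X Y f) {u : X.V} {c : Y.V}
  (hc : Y.graph.Adj (f u) c)

include hf hc in
lemma reach_base (p : PairOrbit X Y u c) :
    Reach (X := (foldSplitting hf u c).expand) (extendMap f u c) (.inr p) (.inl p.1.1) 1 ∧
    Reach (X := (foldSplitting hf u c).expand) (extendMap f u c) (.inl p.1.1) (.inr p) 1 ∧
      Y.graph.Adj (f p.1.1) p.1.2 := by
  have h : Y.graph.Adj (f p.1.1) p.1.2 := by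
    obtain ⟨_, γ, rfl⟩ := p
    simpa only [hf γ u] using Y.smul_adj γ hc
  have hadj := (foldSplitting hf u c).adj_base p
  refine ⟨(Reach.of_adj hadj).mono (dist_eq_one_iff_adj.2 h.symm).le,
    (Reach.of_adj hadj.symm).mono (dist_eq_one_iff_adj.2 h).le, h⟩

include hc in
lemma reach_att (x a : X.V) :
    Reach (X := (foldSplitting hf u c).expand) (extendMap f u c) (.inl x)
      ((foldSplitting hf u c).att x a)
      (Y.graph.dist (f x) (extendMap f u c ((foldSplitting hf u c).att x a))) ∧
    Reach (X := (foldSplitting hf u c).expand) (extendMap f u c)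
      ((foldSplitting hf u c).att x a) (.inl x)
      (Y.graph.dist (f x) (extendMap f u c ((foldSplitting hf u c).att x a))) := by
  have hatt : (foldSplitting hf u c).att x a =
    PairOrbit.lift u c x (Y.graph.toward (f x) (f a)) := rfl
  rcases PairOrbit.lift_cases (x := u) (y := c) x (Y.graph.toward (f x) (f a)) with
    ⟨h, h'⟩ | ⟨h, h'⟩
  · rw [hatt, h']
    have := reach_base hf hc ⟨_, h⟩
    have h2 := (dist_eq_one_iff_adj.2 this.2.2).ge
    exact ⟨this.2.1.mono h2, this.1.mono h2⟩
  · rw [hatt, h']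
    exact ⟨.nil _ _, .nil _ _⟩

/-- The path replacing an edge in the folded tree maps to the same geodesic. -/
lemma dist_att {x a : X.V} (hxa : f x ≠ f a) :
    Y.graph.dist (f x) (extendMap f u c ((foldSplitting hf u c).att x a)) +
    Y.graph.dist (extendMap f u c ((foldSplitting hf u c).att x a))
      (extendMap f u c ((foldSplitting hf u c).att a x)) +
    Y.graph.dist (f a) (extendMap f u c ((foldSplitting hf u c).att a x)) =
      Y.graph.dist (f x) (f a) := by
  have key : ∀ x a : X.V, extendMap f u c ((foldSplitting hf u c).att x a) =
      extendMap f u c (PairOrbit.lift u c x (Y.graph.toward (f x) (f a))) := fun _ _ => rfl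
  rw [key, key]
  have d1 := Y.isTree.dist_toward hxa
  have d2 := dist_eq_one_iff_adj.2 (Y.isTree.adj_toward hxa)
  have d3 := Y.isTree.dist_toward hxa.symm
  have d4 := dist_eq_one_iff_adj.2 (Y.isTree.adj_toward hxa.symm)
  rcases extendMap_lift f u c x (Y.graph.toward (f x) (f a)) with ⟨h, h'⟩ | ⟨h, h'⟩ <;>
  rcases extendMap_lift f u c a (Y.graph.toward (f a) (f x)) with ⟨k, k'⟩ | ⟨k, k'⟩ <;>
  rw [h', k']
  · have hne : Y.graph.toward (f x) (f a) ≠ f a := by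
      intro hx
      have ha : Y.graph.toward (f a) (f x) = f x := by
        rw [hx, dist_self] at d1
        exact Y.isTree.toward_of_adj (dist_eq_one_iff_adj.1 d1.symm).symm
      obtain ⟨γ, hγ⟩ := h
      obtain ⟨δ, hδ⟩ := k
      rw [hx] at hγ
      rw [ha] at hδ
      simp only [Prod.mk.injEq] at hγ hδ
      rw [dist_eq_one_iff_adj, hx] at d2
      refine Y.no_inversions (δ * γ⁻¹) (f x) (f a) d2 ⟨?_, ?_⟩
      · rw [← hf, ← hγ.1, ← hδ.1, X.smul_mul, X.inv_smul_smul]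
      · rw [← hγ.2, ← hδ.2, Y.smul_mul, Y.inv_smul_smul]
    have h1 := Y.isTree.toward_eq_of_between hne.symm
      (show Y.graph.dist (f a) (Y.graph.toward (f x) (f a)) +
        Y.graph.dist (Y.graph.toward (f x) (f a)) (f x) = Y.graph.dist (f a) (f x) by
          rw [dist_comm (u := f a), dist_comm (u := f a), dist_comm (v := f x), d2, d1])
    have h2 := Y.isTree.dist_toward hne.symm
    rw [h1] at h2
    rw [dist_comm (u := Y.graph.toward (f x) (f a))]
    rw [dist_comm (u := f a)] at h2
    lia
  · rw [d2, dist_self]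
    lia
  · rw [dist_comm (u := f x) (v := Y.graph.toward (f a) (f x)), d4, dist_self,
      zero_add, d3, dist_comm]
  · simp

include hc in
/-- Paths survive folding. -/
lemma Reach.fold (hno : ∀ x y, X.graph.Adj x y → f x ≠ f y) {x z : X.V} {n : ℕ}
    (h : Reach f x z n) :
    Reach (X := (foldSplitting hf u c).expand) (extendMap f u c) (.inl x) (.inl z) n := by
  refine h.map (X' := (foldSplitting hf u c).expand) Sum.inl fun x a hxa => ?_
  rw [← dist_att hf (hno _ _ hxa)]
  exact ((reach_att hf hc x a).1.trans (.of_adj ((foldSplitting hf u c).adj_att hxa))).trans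
    (reach_att hf hc a x).2

/-- Folding shortens a turn. -/
lemma reach_fold_turn (hno : ∀ x y, X.graph.Adj x y → f x ≠ f y) {a b : X.V}
    (ha : X.graph.Adj a u) (hb : X.graph.Adj u b)
    (hac : Y.graph.toward (f u) (f a) = c) (hbc : Y.graph.toward (f u) (f b) = c) :
    ∃ n, Reach (X := (foldSplitting hf u c).expand) (extendMap f u c) (.inl a) (.inl b) n ∧
      n < Y.graph.dist (f a) (f u) + Y.graph.dist (f u) (f b) := by
  have hc : Y.graph.Adj (f u) c := by
    rw [← hac]
    exact Y.isTree.adj_toward (hno _ _ ha.symm)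
  have key : ∀ v, Y.graph.toward (f u) (f v) = c →
      (foldSplitting hf u c).att u v = .inr (.pt u c) := by
    rintro v rfl
    exact PairOrbit.lift_self
  have h1 := (reach_att hf hc a u).1.trans (.of_adj ((foldSplitting hf u c).adj_att ha))
  have h2 := Reach.trans (.of_adj ((foldSplitting hf u c).adj_att hb)) (reach_att hf hc b u).2
  rw [key a hac] at h1
  rw [key b hbc] at h2
  refine ⟨_, h1.trans h2, ?_⟩
  have d1 := dist_att hf (u := u) (c := c) (hno _ _ ha)
  have d2 := dist_att hf (u := u) (c := c) (hno _ _ hb)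
  rw [key a hac] at d1
  rw [key b hbc] at d2
  have d3 : Y.graph.dist (f u) (extendMap f u c (.inr (.pt u c))) = 1 :=
    dist_eq_one_iff_adj.2 hc
  lia

end Fold

/-- Equivariant maps between trees of which one is a section of the other, together with the
lengths `K` of paths joining the images of the endpoints of the edges `r i`. -/
structure FoldState {X Y : GTree G} {ι : Type*} (r : ι → Y.Edge) (f : X.V → Y.V) (s : Y.V → X.V)
    (K : ι → ℕ) : Prop where
  map_smul : Equivariant X Y f
  section_smul : Equivariant Y X s
  map_section : ∀ y, f (s y) = y
  finite : Finite X.VQuot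
  reach : ∀ i, Reach f (s (d0 (r i))) (s (d1 (r i))) (K i)

lemma Edge.adj {X : GTree G} (e : X.Edge) : X.graph.Adj (d0 e) (d1 e) := e.2

namespace FoldState

variable {X Y : GTree G} {ι : Type*} {r : ι → Y.Edge} {f : X.V → Y.V} {s : Y.V → X.V} {K : ι → ℕ}

/-- Collapsing an edge whose endpoints have the same image. -/
lemma collapse_of_map_eq (h : FoldState r f s K) {a b : X.V} (hab : X.graph.Adj a b)
    (hne : ∀ γ, X.smul γ a ≠ b) (hst : X.stab a ≤ X.stab b) (hf : f a = f b) :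
    FoldState (X := X.collapse hab hne hst) r (fun v => f v.1) (fun y => X.retract hne (s y)) K := by
  have key : ∀ v, f (X.retract hne v).1 = f v := by
    intro v
    by_cases hv : ∃ γ, X.smul γ a = v
    · obtain ⟨γ, rfl⟩ := hv
      rw [X.retract_smul_left hne hst, h.map_smul, h.map_smul, hf]
    · rw [X.retract_of_forall_ne hne (not_exists.1 hv)]
  refine ⟨fun γ v => h.map_smul γ v.1, fun γ y => ?_, fun y => ?_,
    (X.card_vquot_collapse hab hne hst h.finite).1, fun i => ?_⟩
  · rw [h.section_smul]
    exact X.retract_smul hne hst γ _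
  · rw [key, h.map_section]
  · refine (h.reach i).map (X' := X.collapse hab hne hst) (X.retract hne) fun x y hxy => ?_
    by_cases hr : X.retract hne x = X.retract hne y
    · rw [hr]
      exact .nil _ _
    · have := Reach.of_adj (X := X.collapse hab hne hst) (f := fun v => f v.1)
        (X.collapseGraph_adj_retract hne hxy hr)
      simpa only [key] using this

/-- Collapsing an edge outside the image of a section which is a graph homomorphism. -/
lemma collapse_of_notMem (h : FoldState r f s K)
    (hs : ∀ y y', Y.graph.Adj y y' → X.graph.Adj (s y) (s y')) {a b : X.V} (hab : X.graph.Adj a b)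
    (hne : ∀ γ, X.smul γ a ≠ b) (hst : X.stab a ≤ X.stab b) (ha : ∀ y, s y ≠ a) :
    FoldState (X := X.collapse hab hne hst) r (fun v => f v.1) (fun y => X.retract hne (s y)) K := by
  have ha' : ∀ y γ, X.smul γ a ≠ s y := fun y γ hγ => ha (Y.smul γ⁻¹ y) (by
    rw [h.section_smul, ← hγ, X.inv_smul_smul])
  have key : ∀ y, f (X.retract hne (s y)).1 = y := by
    intro y
    rw [X.retract_of_forall_ne hne (ha' y), h.map_section]
  refine ⟨fun γ v => h.map_smul γ v.1, fun γ y => ?_, key,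
    (X.card_vquot_collapse hab hne hst h.finite).1, fun i => ?_⟩
  · rw [h.section_smul]
    exact X.retract_smul hne hst γ _
  · have hr : X.retract hne (s (d0 (r i))) ≠ X.retract hne (s (d1 (r i))) := fun he =>
      (r i).adj.ne (by rw [← key (d0 (r i)), he, key])
    have h1 := Reach.of_adj (X := X.collapse hab hne hst) (f := fun v => f v.1)
      (X.collapseGraph_adj_retract hne (hs _ _ (r i).adj) hr)
    refine h1.mono ?_
    have h2 := (h.reach i).dist_le
    rw [h.map_section, h.map_section] at h2
    change Y.graph.dist (f (X.retract hne (s (d0 (r i)))).1)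
      (f (X.retract hne (s (d1 (r i)))).1) ≤ _
    rwa [key, key]

/-- An edge whose endpoints have the same image can be collapsed. -/
lemma exists_collapsible (h : FoldState r f s K) {a b : X.V} (hab : X.graph.Adj a b)
    (hf : f a = f b) : ∃ a b, X.graph.Adj a b ∧ f a = f b ∧ (∀ γ, X.smul γ a ≠ b) ∧
      X.stab a ≤ X.stab b := by
  obtain ⟨p, hp⟩ : ∃ p, p = s (f a) := ⟨_, rfl⟩
  have hfix : ∀ v, f v = f a → ∀ γ w, X.smul γ v = w → f w = f a → X.smul γ p = p := by
    intro v hv γ w hw hw'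
    rw [hp, ← h.section_smul]
    congr 1
    rw [← hv, ← h.map_smul, hw, hw', hv]
  have key : ∀ a' b', X.graph.Adj a' b' → f a' = f a → f b' = f a →
      X.graph.dist a' p = X.graph.dist b' p + 1 →
      ∃ a b, X.graph.Adj a b ∧ f a = f b ∧ (∀ γ, X.smul γ a ≠ b) ∧ X.stab a ≤ X.stab b := by
    intro a' b' hab' ha' hb' hd
    refine ⟨a', b', hab', ha'.trans hb'.symm, fun γ hγ => ?_, fun γ hγ => ?_⟩
    · have := X.dist_smul γ a' p
      rw [hγ, hfix a' ha' γ b' hγ hb'] at this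
      lia
    · rw [mem_stab] at hγ ⊢
      have hb := X.isTree.eq_toward hab' hd.symm
      rw [hb, X.smul_toward, hγ, hfix a' ha' γ a' hγ ha']
  rcases X.isTree.dist_eq_dist_add_one_of_adj p hab with hd | hd
  · exact key a b hab rfl hf.symm (by rwa [dist_comm, dist_comm (u := b)])
  · exact key b a hab.symm hf.symm rfl (by rwa [dist_comm, dist_comm (u := a)])

/-- If the section is a graph homomorphism, then it is an isomorphism, or there is a collapsible
edge outside its image. -/
lemma isGIso_or_exists (h : FoldState r f s K)
    (hs : ∀ y y', Y.graph.Adj y y' → X.graph.Adj (s y) (s y')) :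
    IsGIso Y X s ∨ ∃ a b, X.graph.Adj a b ∧ (∀ γ, X.smul γ a ≠ b) ∧ X.stab a ≤ X.stab b ∧
      ∀ y, s y ≠ a := by
  have hinj : Function.Injective s := Function.LeftInverse.injective h.map_section
  by_cases hsurj : Function.Surjective s
  · refine .inl ⟨⟨hinj, hsurj⟩, fun y y' => ⟨hs y y', fun hadj => ?_⟩, h.section_smul⟩
    let F : Y.graph →g X.graph := ⟨s, fun {a b} => hs a b⟩
    obtain ⟨p, hp⟩ := Y.isTree.1.exists_isPath y y'
    have hp' : (p.map F).IsPath := hp.map hinj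
    have := (X.isTree.2.subsingleton_path _ _).elim ⟨p.map F, hp'⟩ (Path.singleton hadj)
    have hl := congrArg (fun q : X.graph.Path (s y) (s y') => q.1.length) this
    simp only [Walk.length_map, Path.singleton] at hl
    exact Walk.adj_of_length_eq_one hl
  · right
    simp only [Function.Surjective, not_forall, not_exists] at hsurj
    obtain ⟨x, hx⟩ := hsurj
    obtain ⟨w⟩ := X.isTree.1 x (s (f x))
    obtain ⟨d, -, hd1, hd2⟩ := w.exists_boundary_dart {v | ∀ y, s y ≠ v} hx
      (by simp)
    simp only [Set.mem_ofPred_eq, not_forall, not_not] at hd1 hd2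
    obtain ⟨y, hy⟩ := hd2
    have hconst : ∀ y', X.graph.toward d.fst (s y) = X.graph.toward d.fst (s y') := by
      intro y'
      obtain ⟨w⟩ := Y.isTree.1 y y'
      clear hy
      induction w with
      | nil => rfl
      | cons hadj _ ih =>
        rw [← ih]
        exact X.isTree.toward_eq_toward_of_adj (hs _ _ hadj) (hd1 _) (hd1 _)
    refine ⟨d.fst, d.snd, d.adj, fun γ hγ => hd1 (Y.smul γ⁻¹ y) ?_, fun γ hγ => ?_, hd1⟩
    · rw [h.section_smul, hy, ← hγ, X.inv_smul_smul]
    · rw [mem_stab] at hγ ⊢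
      have hb : d.snd = X.graph.toward d.fst (s (f d.fst)) := by
        rw [← hconst, hy, X.isTree.toward_of_adj d.adj]
      rw [hb, X.smul_toward, hγ, ← h.section_smul, ← h.map_smul, hγ]

/-- The state after a fold. -/
lemma fold [DecidableEq ι] (h : FoldState r f s K) (hno : ∀ x y, X.graph.Adj x y → f x ≠ f y)
    {u : X.V} {c : Y.V} (hc : Y.graph.Adj (f u) c) {i : ι} {n : ℕ}
    (hn : Reach (X := (foldSplitting h.map_smul u c).expand) (extendMap f u c)
      (.inl (s (d0 (r i)))) (.inl (s (d1 (r i)))) n) :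
    FoldState (X := (foldSplitting h.map_smul u c).expand) r (extendMap f u c)
      (fun y => .inl (s y)) (Function.update K i n) := by
  refine ⟨h.map_smul.extendMap _, fun γ y => congrArg Sum.inl (h.section_smul γ y),
    h.map_section, Splitting.finite_vquot_expand _ h.finite (.pt u c) PairOrbit.exists_smul_pt,
    fun j => ?_⟩
  by_cases hj : j = i
  · subst hj
    rwa [Function.update_self]
  · rw [Function.update_of_ne hj]
    exact (h.reach j).fold h.map_smul hc hno

/-- If the path associated with the edge `r i` is not a single edge, then it can be shortened by
a fold. -/
lemma exists_fold (h : FoldState r f s K) (hno : ∀ x y, X.graph.Adj x y → f x ≠ f y) {i : ι}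
    (hi : ¬ X.graph.Adj (s (d0 (r i))) (s (d1 (r i)))) :
    ∃ (u : X.V) (c : Y.V) (n : ℕ), Y.graph.Adj (f u) c ∧ n < K i ∧
      Reach (X := (foldSplitting h.map_smul u c).expand) (extendMap f u c)
        (.inl (s (d0 (r i)))) (.inl (s (d1 (r i)))) n := by
  rcases (h.reach i).geodesic_or_turn hno with hg | ⟨a, u, b, n₁, n₂, h1, h2, h3, h4, h5, h6⟩
  · rw [h.map_section, h.map_section, dist_eq_one_iff_adj.2 (r i).adj] at hg
    exact absurd (hg.adj_of_one hno fun he => (r i).adj.ne (by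
      rw [← h.map_section (d0 (r i)), he, h.map_section])) hi
  · have hc := Y.isTree.adj_toward (hno _ _ h2.symm)
    obtain ⟨n, hn, hlt⟩ := reach_fold_turn h.map_smul hno h2 h3 rfl h6.symm
    exact ⟨u, _, _, hc, by lia, ((h1.fold h.map_smul hc hno).trans hn).trans
      (h4.fold h.map_smul hc hno)⟩

lemma elemDeformation [Finite ι] (hr : ∀ e : Y.Edge, ∃ i γ, edgeSmul γ (r i) = e)
    (h : FoldState r f s K) : ElemDeformation X Y := by
  classical
  have := Fintype.ofFinite ι
  induction hN : ∑ i, K i using Nat.strong_induction_on generalizing X K with | _ N ihN =>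
  induction hk : Nat.card X.VQuot using Nat.strong_induction_on generalizing X with | _ k ihk =>
  by_cases hno : ∀ x y, X.graph.Adj x y → f x ≠ f y
  · by_cases hadj : ∀ i, X.graph.Adj (s (d0 (r i))) (s (d1 (r i)))
    · have hs : ∀ y y', Y.graph.Adj y y' → X.graph.Adj (s y) (s y') := by
        intro y y' hy
        obtain ⟨i, γ, he⟩ := hr ⟨(y, y'), hy⟩
        have h1 : Y.smul γ (d0 (r i)) = y := congrArg (fun e => e.1.1) he
        have h2 : Y.smul γ (d1 (r i)) = y' := congrArg (fun e => e.1.2) he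
        rw [← h1, ← h2, h.section_smul, h.section_smul]
        exact X.smul_adj γ (hadj i)
      rcases h.isGIso_or_exists hs with hiso | ⟨a, b, hab, hne, hst, ha⟩
      · exact .symm _ _ hiso.elemDeformation
      · have h' := h.collapse_of_notMem hs hab hne hst ha
        have hlt := (X.card_vquot_collapse hab hne hst h.finite).2
        exact .trans _ _ _ (.rel _ _ ⟨_, _, X.isCollapse_retract hab hne hst⟩)
          (ihk _ (hk ▸ hlt) h' rfl)
    · obtain ⟨i, hi⟩ := not_forall.1 hadj
      obtain ⟨u, c, n, hc, hn, hreach⟩ := h.exists_fold hno hi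
      refine .trans _ _ _ (foldSplitting h.map_smul u c).elemDeformation_expand
        (ihN _ ?_ (h.fold hno hc hreach) rfl)
      rw [← hN]
      refine Finset.sum_lt_sum (fun j _ => ?_) ⟨i, Finset.mem_univ i, by simpa using hn⟩
      by_cases hj : j = i
      · subst hj
        simpa using hn.le
      · rw [Function.update_of_ne hj]
  · simp only [not_forall, not_not] at hno
    obtain ⟨x, y, hxy, hf⟩ := hno
    obtain ⟨a, b, hab, hf, hne, hst⟩ := h.exists_collapsible hxy hf
    have h' := h.collapse_of_map_eq hab hne hst hf
    have hlt := (X.card_vquot_collapse hab hne hst h.finite).2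
    exact .trans _ _ _ (.rel _ _ ⟨_, _, X.isCollapse_retract hab hne hst⟩)
      (ihk _ (hk ▸ hlt) h' rfl)

end FoldState

/-- After attaching leaves, an equivariant map has an equivariant section. -/
lemma exists_section {X Y : GTree G} (hX : Finite X.VQuot) (hY : Finite Y.VQuot) {f : X.V → Y.V}
    {g : Y.V → X.V} (hf : Equivariant X Y f) (hg : Equivariant Y X g) :
    ∃ (X' : GTree G) (f' : X'.V → Y.V) (s : Y.V → X'.V), ElemDeformation X X' ∧
      Finite X'.VQuot ∧ Equivariant X' Y f' ∧ Equivariant Y X' s ∧ ∀ y, f' (s y) = y := by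
  induction hn : {q : Y.VQuot | ∃ y, VQuot.mk y = q ∧ f (g y) ≠ y}.ncard
    using Nat.strong_induction_on generalizing X with | _ n ih =>
  by_cases hfg : ∀ y, f (g y) = y
  · exact ⟨X, f, g, .refl _, hX, hf, hg, hfg⟩
  · obtain ⟨y, hy⟩ := not_forall.1 hfg
    let S := leafSplitting X Y (g y) y
    let g' : Y.V → S.expand.V := fun y' => PairOrbit.lift (g y) y (g y') y'
    have hg' : Equivariant Y S.expand g' := fun γ y' => by
      simp only [g', hg γ y']
      exact PairOrbit.lift_smul γ _ _
    have hlt : {q : Y.VQuot | ∃ y', VQuot.mk y' = q ∧ extendMap f (g y) y (g' y') ≠ y'}.ncard <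
        n := by
      rw [← hn]
      refine Set.ncard_lt_ncard (Set.ssubset_iff_exists.2 ⟨?_, VQuot.mk y, ⟨y, rfl, hy⟩, ?_⟩)
        (Set.toFinite _)
      · rintro _ ⟨y', rfl, hy'⟩
        refine ⟨y', rfl, ?_⟩
        rcases extendMap_lift f (g y) y (g y') y' with ⟨-, h⟩ | ⟨-, h⟩
        · exact absurd h hy'
        · rwa [← h]
      · rintro ⟨y', hyy', hy'⟩
        obtain ⟨γ, rfl⟩ := VQuot.mk_eq_iff.1 hyy'.symm
        rcases extendMap_lift f (g y) y (g (Y.smul γ y)) (Y.smul γ y) with ⟨-, h⟩ | ⟨h, -⟩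
        · exact hy' h
        · exact h ⟨γ, by rw [hg]⟩
    obtain ⟨X', f', s, h1, h2⟩ := ih _ hlt
      (S.finite_vquot_expand hX (.pt _ _) PairOrbit.exists_smul_pt) (hf.extendMap S) hg' rfl
    exact ⟨X', f', s, .trans _ _ _ S.elemDeformation_expand h1, h2⟩

lemma exists_edge_representatives {Y : GTree G} (hY : Y.Cocompact) :
    ∃ (ι : Type u) (_ : Finite ι) (r : ι → Y.Edge), ∀ e, ∃ i γ, edgeSmul γ (r i) = e := by
  refine ⟨_, hY.2, Quot.out, fun e => ⟨Quot.mk _ e, ?_⟩⟩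
  refine (Equivalence.eqvGen_iff (r := fun e f : Y.Edge => ∃ γ, edgeSmul γ e = f)
    ⟨fun x => ⟨1, ?_⟩, ?_, ?_⟩).1 (Quot.eqvGen_exact (Quot.out_eq (Quot.mk _ e)))
  · exact Subtype.ext (Prod.ext (Y.smul_one _) (Y.smul_one _))
  · rintro x _ ⟨γ, rfl⟩
    exact ⟨γ⁻¹, Subtype.ext (Prod.ext (Y.inv_smul_smul γ _) (Y.inv_smul_smul γ _))⟩
  · rintro x _ _ ⟨γ, rfl⟩ ⟨δ, rfl⟩
    exact ⟨δ * γ, Subtype.ext (Prod.ext (Y.smul_mul δ γ _) (Y.smul_mul δ γ _))⟩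

lemma SameEllipticSubgroups.exists_equivariant {X Y : GTree G} (h : X.SameEllipticSubgroups Y) :
    ∃ f : X.V → Y.V, Equivariant X Y f :=
  GTree.exists_equivariant fun x => (h (X.stab x)).1 ⟨x, fun _ hγ => hγ⟩

lemma SameEllipticSubgroups.symm {X Y : GTree G} (h : X.SameEllipticSubgroups Y) :
    Y.SameEllipticSubgroups X := fun H => (h H).symm

lemma SameEllipticSubgroups.elemDeformation {X Y : GTree G} (h : X.SameEllipticSubgroups Y)
    (hX : X.Cocompact) (hY : Y.Cocompact) : ElemDeformation X Y := by
  obtain ⟨f, hf⟩ := h.exists_equivariant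
  obtain ⟨g, hg⟩ := h.symm.exists_equivariant
  obtain ⟨X', f', s, h1, h2, h3, h4, h5⟩ := exists_section hX.1 hY.1 hf hg
  obtain ⟨ι, _, r, hr⟩ := exists_edge_representatives hY
  choose K hK using fun i => Reach.exists_of_tree f' (s (d0 (r i))) (s (d1 (r i)))
  exact .trans _ _ _ h1 (FoldState.elemDeformation hr ⟨h3, h4, h5, h2, hK⟩)

end GTree

open GTree in
/-- Theorem 7.2: let `G` be a group and let `X` and `Y` be cocompact
`G`-trees.  The following are equivalent:
(1) `X` and `Y` have the same elliptic subgroups;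
(2) there exists an elementary deformation from `X` to `Y`;
(3) there exists a coarsely equivariant quasi-isometry `φ : X → Y`. -/
theorem sameElliptic_iff_elemDeformation_iff_qi {G : Type u} [Group G]
    (X Y : GTree G) (hXc : X.Cocompact) (hYc : Y.Cocompact) :
    (X.SameEllipticSubgroups Y ↔ ElemDeformation X Y) ∧
    (ElemDeformation X Y ↔
      ∃ φ : X.V → Y.V, IsQuasiIsometry X Y φ ∧ CoarselyEquivariant X Y φ) := by
  have key : X.SameEllipticSubgroups Y → ElemDeformation X Y := fun h => h.elemDeformation hXc hYc
  exact ⟨⟨key, fun h => h.equivariantQI.sameElliptic⟩,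
    ⟨fun h => h.equivariantQI.exists_quasiIsometry,
      fun ⟨_, hq, he⟩ => key (sameElliptic_of_quasiIsometry hq he)⟩⟩
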